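/- The HyperQPTL model checking problem is decidable: there is an algorithm that, given a finite Kripke structure K and a HyperQPTL sentence φ, decides whether K ⊨ φ. -/

import Mathlib

/-!
STATEMENT 1: The HyperQPTL model checking problem is decidable: there is an
algorithm that, given a finite Kripke structure K and a HyperQPTL sentence φ,
decides whether K ⊨ φ.
-/

/-- A trace over the atomic propositions (drawn from `ℕ`). -/
abbrev Trace : Type := ℕ → Set ℕ

/-- Quantifier-free HyperQPTL formulas: `a_π | q | ¬ψ | ψ ∧ ψ | X ψ | ψ U ψ`. -/
inductive QF : Type
  | atom : ℕ → ℕ → QF            -- `a_π` (proposition, trace variable)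
  | patom : ℕ → QF               -- quantified proposition `q`
  | not : QF → QF
  | and : QF → QF → QF
  | next : QF → QF
  | xuntil : QF → QF → QF

/-- Satisfaction of a quantifier-free formula w.r.t. a trace assignment `Pi`,
an assignment `σ` of quantified propositions to the sets of positions where
they hold (i.e. to sequences in `(2^{q})^ω`), and a position `i`. -/
def QF.Sat (Pi : ℕ → Trace) (σ : ℕ → Set ℕ) : ℕ → QF → Prop
  | i, .atom a π => a ∈ Pi π i
  | i, .patom q => i ∈ σ q
  | i, .not ψ => ¬ QF.Sat Pi σ i ψ
  | i, .and ψ₁ ψ₂ => QF.Sat Pi σ i ψ₁ ∧ QF.Sat Pi σ i ψ₂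
  | i, .next ψ => QF.Sat Pi σ (i + 1) ψ
  | i, .xuntil ψ₁ ψ₂ =>
      ∃ k, i ≤ k ∧ QF.Sat Pi σ k ψ₂ ∧ ∀ j, i ≤ j → j < k → QF.Sat Pi σ j ψ₁

/-- Trace variables occurring in a quantifier-free formula. -/
def QF.tvars : QF → Finset ℕ
  | .atom _ π => {π}
  | .patom _ => ∅
  | .not ψ => ψ.tvars
  | .and ψ₁ ψ₂ => ψ₁.tvars ∪ ψ₂.tvars
  | .next ψ => ψ.tvars
  | .xuntil ψ₁ ψ₂ => ψ₁.tvars ∪ ψ₂.tvars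

/-- Propositional variables occurring in a quantifier-free formula. -/
def QF.pvars : QF → Finset ℕ
  | .atom _ _ => ∅
  | .patom q => {q}
  | .not ψ => ψ.pvars
  | .and ψ₁ ψ₂ => ψ₁.pvars ∪ ψ₂.pvars
  | .next ψ => ψ.pvars
  | .xuntil ψ₁ ψ₂ => ψ₁.pvars ∪ ψ₂.pvars

/-- HyperQPTL formulas: a block of trace quantifiers and propositional
quantifiers followed by a quantifier-free formula. -/
inductive HyperQPTL : Type
  | qf : QF → HyperQPTL
  | ex : ℕ → HyperQPTL → HyperQPTL      -- `∃π.φ`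
  | all : ℕ → HyperQPTL → HyperQPTL     -- `∀π.φ`
  | pex : ℕ → HyperQPTL → HyperQPTL     -- `∃q.φ`
  | pall : ℕ → HyperQPTL → HyperQPTL    -- `∀q.φ`

/-- Satisfaction `T, Π, i ⊨ φ` of a HyperQPTL formula over a set of traces `T`.
Propositional quantifiers range over arbitrary sequences in `(2^{q})^ω`,
modeled as arbitrary sets of positions. -/
def HyperQPTL.Sat (T : Set Trace) :
    (ℕ → Trace) → (ℕ → Set ℕ) → ℕ → HyperQPTL → Prop
  | Pi, σ, i, .qf ψ => QF.Sat Pi σ i ψ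
  | Pi, σ, i, .ex π φ => ∃ t ∈ T, HyperQPTL.Sat T (Function.update Pi π t) σ i φ
  | Pi, σ, i, .all π φ => ∀ t ∈ T, HyperQPTL.Sat T (Function.update Pi π t) σ i φ
  | Pi, σ, i, .pex q φ =>
      ∃ s : Set ℕ, HyperQPTL.Sat T Pi (Function.update σ q s) i φ
  | Pi, σ, i, .pall q φ =>
      ∀ s : Set ℕ, HyperQPTL.Sat T Pi (Function.update σ q s) i φ

/-- Free trace variables of a HyperQPTL formula. -/
def HyperQPTL.freeT : HyperQPTL → Finset ℕ
  | .qf ψ => ψ.tvars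
  | .ex π φ => φ.freeT \ {π}
  | .all π φ => φ.freeT \ {π}
  | .pex _ φ => φ.freeT
  | .pall _ φ => φ.freeT

/-- Free propositional variables of a HyperQPTL formula. -/
def HyperQPTL.freeP : HyperQPTL → Finset ℕ
  | .qf ψ => ψ.pvars
  | .ex _ φ => φ.freeP
  | .all _ φ => φ.freeP
  | .pex q φ => φ.freeP \ {q}
  | .pall q φ => φ.freeP \ {q}

/-- A HyperQPTL sentence is a closed formula. -/
def HyperQPTL.Closed (φ : HyperQPTL) : Prop := φ.freeT = ∅ ∧ φ.freeP = ∅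

/-- `T ⊨ φ` iff `T, ∅, 0 ⊨ φ`. -/
def TSat (T : Set Trace) (φ : HyperQPTL) : Prop :=
  HyperQPTL.Sat T (fun _ _ => (∅ : Set ℕ)) (fun _ => (∅ : Set ℕ)) 0 φ

/-- A finite Kripke structure: finitely many states `Fin n`, an initial state,
a transition function with nonempty successor sets, and a state labeling. -/
structure FinKripke where
  n : ℕ
  init : Fin n
  trans : Fin n → Finset (Fin n)
  trans_nonempty : ∀ s, (trans s).Nonempty
  label : Fin n → Finset ℕ

/-- Paths of a finite Kripke structure starting in the initial state. -/
def FinKripke.IsPath (K : FinKripke) (p : ℕ → Fin K.n) : Prop :=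
  p 0 = K.init ∧ ∀ i, p (i + 1) ∈ K.trans (p i)

/-- The set of traces of paths of `K` starting in the initial state. -/
def FinKripke.Traces (K : FinKripke) : Set Trace :=
  { t | ∃ p, K.IsPath p ∧ t = fun i => ((K.label (p i) : Finset ℕ) : Set ℕ) }

/-- `K ⊨ φ` iff `Tr(K, s₀) ⊨ φ`. -/
def FinKripke.Models (K : FinKripke) (φ : HyperQPTL) : Prop :=
  TSat K.Traces φ

/-- An explicit (injective) numerical encoding of quantifier-free formulas. -/
def QF.enc : QF → ℕ
  | .atom a π => Nat.pair 0 (Nat.pair a π)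
  | .patom q => Nat.pair 1 q
  | .not ψ => Nat.pair 2 ψ.enc
  | .and ψ₁ ψ₂ => Nat.pair 3 (Nat.pair ψ₁.enc ψ₂.enc)
  | .next ψ => Nat.pair 4 ψ.enc
  | .xuntil ψ₁ ψ₂ => Nat.pair 5 (Nat.pair ψ₁.enc ψ₂.enc)

/-- An explicit (injective) numerical encoding of HyperQPTL formulas. -/
def HyperQPTL.enc : HyperQPTL → ℕ
  | .qf ψ => Nat.pair 0 ψ.enc
  | .ex π φ => Nat.pair 1 (Nat.pair π φ.enc)
  | .all π φ => Nat.pair 2 (Nat.pair π φ.enc)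
  | .pex q φ => Nat.pair 3 (Nat.pair q φ.enc)
  | .pall q φ => Nat.pair 4 (Nat.pair q φ.enc)

/-- An explicit (injective) numerical encoding of finite Kripke structures. -/
def FinKripke.enc (K : FinKripke) : ℕ :=
  Nat.pair K.n (Nat.pair K.init.val (Nat.pair
    (Encodable.encode
      ((List.finRange K.n).map fun s => ((K.trans s).sort (· ≤ ·)).map Fin.val))
    (Encodable.encode
      ((List.finRange K.n).map fun s => (K.label s).sort (· ≤ ·)))))

namespace HQ

/-- Environments: every variable is assigned an infinite sequence of letters. -/
abbrev Env (A : Type) := ℕ → ℕ → A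

/-- `P` is recognised by a finite typing of segments with at most `N` types. -/
def Recog {A β : Type} (P : Env A → ℕ → β) (N : ℕ) : Prop :=
  ∃ (S : Type) (_ : Fintype S) (τ : Env A → ℕ → ℕ → S), Fintype.card S ≤ N ∧
   (∀ w w' i i' d, (∀ v t, t < d → w v (i+t) = w' v (i'+t)) →
      τ w i (i+d) = τ w' i' (i'+d)) ∧
   (∀ w w' i j k i' j' k', i ≤ j → j ≤ k → i' ≤ j' → j' ≤ k' →
      τ w i j = τ w' i' j' → τ w j k = τ w' j' k' → τ w i k = τ w' i' k') ∧
   (∀ w w' a b, StrictMono a → StrictMono b →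
      (∀ n, τ w (a n) (a (n+1)) = τ w' (b n) (b (n+1))) → P w (a 0) = P w' (b 0))

theorem Recog.mono {A β : Type} {P : Env A → ℕ → β} {N N' : ℕ} (h : Recog P N) (hN : N ≤ N') :
    Recog P N' := by
  obtain ⟨S, i, τ, h1, h2⟩ := h
  exact ⟨S, i, τ, h1.trans hN, h2⟩

theorem Recog.map {A β γ : Type} {P : Env A → ℕ → β} {N : ℕ} (h : Recog P N) (g : β → γ) :
    Recog (fun w i => g (P w i)) N := by
  obtain ⟨S, i, τ, h1, h2, h3, h4⟩ := h
  refine ⟨S, i, τ, h1, h2, h3, ?_⟩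
  intro w w' a b ha hb hab
  exact congrArg g (h4 w w' a b ha hb hab)

theorem Recog.pair {A β γ : Type} {P : Env A → ℕ → β} {Q : Env A → ℕ → γ} {N N' : ℕ}
    (h : Recog P N) (h' : Recog Q N') :
    Recog (fun w i => (P w i, Q w i)) (N * N') := by
  obtain ⟨S, _, τ, h1, h2, h3, h4⟩ := h
  obtain ⟨S', _, τ', h1', h2', h3', h4'⟩ := h'
  refine ⟨S × S', inferInstance, fun w i j => (τ w i j, τ' w i j), ?_, ?_, ?_, ?_⟩
  · rw [Fintype.card_prod]; exact Nat.mul_le_mul h1 h1'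
  · intro w w' i i' d h
    simp only [h2 w w' i i' d h, h2' w w' i i' d h]
  · intro w w' i j k i' j' k' a1 a2 a3 a4 e1 e2
    simp only [Prod.mk.injEq] at e1 e2 ⊢
    exact ⟨h3 w w' i j k i' j' k' a1 a2 a3 a4 e1.1 e2.1,
      h3' w w' i j k i' j' k' a1 a2 a3 a4 e1.2 e2.2⟩
  · intro w w' a b ha hb hab
    simp only [Prod.mk.injEq] at hab ⊢
    exact ⟨h4 w w' a b ha hb fun n => (hab n).1, h4' w w' a b ha hb fun n => (hab n).2⟩

theorem Recog.letter {A : Type} [Fintype A] (v : ℕ) :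
    Recog (fun (w : Env A) i => w v i) (Fintype.card A + 1) := by
  refine ⟨Option A, inferInstance, fun w i j => if i < j then some (w v i) else none, ?_, ?_, ?_, ?_⟩
  · rw [Fintype.card_option]
  · intro w w' i i' d h
    rcases Nat.eq_zero_or_pos d with rfl | hd
    · simp
    · have := h v 0 hd
      simp only [Nat.add_zero] at this
      simp [hd, this]
  · intro w w' i j k i' j' k' a1 a2 a3 a4 e1 e2
    dsimp only at e1 e2 ⊢
    by_cases hij : i < j
    · by_cases hij' : i' < j'
      · have : i < k := by omega
        have : i' < k' := by omega
        simp_all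
      · simp [hij, hij'] at e1
    · by_cases hij' : i' < j'
      · simp [hij, hij'] at e1
      · have : i = j := by omega
        have : i' = j' := by omega
        subst i; subst i'; exact e2
  · intro w w' a b ha hb hab
    have := hab 0
    have h1 : a 0 < a (0+1) := ha (by omega)
    have h2 : b 0 < b (0+1) := hb (by omega)
    simpa [h1, h2] using this

theorem strictMono_cons {a : ℕ → ℕ} (ha : StrictMono a) (n k : ℕ) (hk : k < a (n+1)) :
    StrictMono (fun j : ℕ => Nat.casesOn j k (fun j => a (n+1+j)) : ℕ → ℕ) := by
  refine strictMono_nat_of_lt_succ ?_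
  rintro (_ | j)
  · simpa using hk
  · exact ha (by omega)

/-- Comparison of suffixes that start inside a block. -/
theorem sat_suffix {A β S : Type} {P : Env A → ℕ → β} {τ : Env A → ℕ → ℕ → S}
    (h4 : ∀ w w' a b, StrictMono a → StrictMono b →
      (∀ n, τ w (a n) (a (n+1)) = τ w' (b n) (b (n+1))) → P w (a 0) = P w' (b 0))
    {w w' : Env A} {a b : ℕ → ℕ} (ha : StrictMono a) (hb : StrictMono b)
    (hab : ∀ n, τ w (a n) (a (n+1)) = τ w' (b n) (b (n+1))) {n k k' : ℕ}
    (hk : k < a (n+1)) (hk' : k' < b (n+1)) (h : τ w k (a (n+1)) = τ w' k' (b (n+1))) :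
    P w k = P w' k' := by
  refine h4 w w' _ _ (strictMono_cons ha n k hk) (strictMono_cons hb n k' hk') ?_
  rintro (_ | j)
  · exact h
  · exact hab (n+1+j)

theorem exists_block {a : ℕ → ℕ} (ha : StrictMono a) {i : ℕ} (hi : a 0 ≤ i) :
    ∃ n, a n ≤ i ∧ i < a (n+1) := by
  have hex : ∃ n, i < a (n+1) := ⟨i, lt_of_lt_of_le (Nat.lt_succ_self i) (ha.le_apply)⟩
  classical
  refine ⟨Nat.find hex, ?_, Nat.find_spec hex⟩
  rcases h : Nat.find hex with _ | k
  · exact hi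
  · have := Nat.find_min hex (m := k) (by omega)
    omega

theorem Recog.next {A β : Type} {P : Env A → ℕ → β} {N : ℕ} (h : Recog P N) :
    Recog (fun w i => P w (i+1)) (N * (N + 1)) := by
  obtain ⟨S, _, τ, h1, h2, h3, h4⟩ := h
  refine ⟨S × Option S, inferInstance,
    fun w i j => (τ w i j, if i < j then some (τ w (i+1) j) else none), ?_, ?_, ?_, ?_⟩
  · rw [Fintype.card_prod, Fintype.card_option]; exact Nat.mul_le_mul h1 (by omega)
  · intro w w' i i' d h
    have e := h2 w w' i i' d h
    rcases Nat.eq_zero_or_pos d with rfl | hd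
    · simpa using e
    · obtain ⟨d, rfl⟩ : ∃ d', d = d' + 1 := ⟨d - 1, by omega⟩
      have e' := h2 w w' (i+1) (i'+1) d (by
        intro v t ht
        have := h v (t+1) (by omega)
        rw [show i + 1 + t = i + (t+1) by omega, show i' + 1 + t = i' + (t+1) by omega]
        exact this)
      rw [show i + 1 + d = i + (d+1) by omega, show i' + 1 + d = i' + (d+1) by omega] at e'
      simp [e, e']
  · intro w w' i j k i' j' k' a1 a2 a3 a4 e1 e2
    simp only [Prod.mk.injEq] at e1 e2 ⊢
    refine ⟨h3 w w' i j k i' j' k' a1 a2 a3 a4 e1.1 e2.1, ?_⟩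
    by_cases hij : i < j
    · by_cases hij' : i' < j'
      · have h5 : i < k := by omega
        have h6 : i' < k' := by omega
        have e3 := e1.2
        simp only [hij, hij', if_true, Option.some.injEq] at e3
        simp only [h5, h6, if_true, Option.some.injEq]
        exact h3 w w' (i+1) j k (i'+1) j' k' hij a2 hij' a4 e3 e2.1
      · simp [hij, hij'] at e1
    · by_cases hij' : i' < j'
      · simp [hij, hij'] at e1
      · have : i = j := by omega
        have : i' = j' := by omega
        subst i; subst i'; exact e2.2
  · intro w w' a b ha hb hab
    simp only [Prod.mk.injEq] at hab
    have ha2 : a 0 + 1 < a 2 := by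
      have := @ha 0 1 (by omega); have := @ha 1 2 (by omega); omega
    have hb2 : b 0 + 1 < b 2 := by
      have := @hb 0 1 (by omega); have := @hb 1 2 (by omega); omega
    refine sat_suffix h4 ha hb (fun n => (hab n).1) (n := 1) ha2 hb2 ?_
    have e := (hab 0).2
    have h7 : a 0 < a (0+1) := ha (by omega)
    have h8 : b 0 < b (0+1) := hb (by omega)
    simp only [h7, h8, if_true, Option.some.injEq] at e
    exact h3 w w' _ (a (0+1)) _ _ (b (0+1)) _ h7 (ha.monotone (by omega)) h8
      (hb.monotone (by omega)) e (hab 1).1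

theorem update_loc {A : Type} {w w' : Env A} {v : ℕ} {x x' : ℕ → A} {i i' d : ℕ}
    (h : ∀ u t, t < d → w u (i+t) = w' u (i'+t)) (hx : ∀ t, t < d → x (i+t) = x' (i'+t)) :
    ∀ u t, t < d → Function.update w v x u (i+t) = Function.update w' v x' u (i'+t) := by
  intro u t ht
  by_cases hu : u = v
  · subst hu; simpa using hx t ht
  · simpa [hu] using h u t ht

theorem Recog.ex {A : Type} {P : Env A → ℕ → Prop} {N : ℕ} (h : Recog P N) (v : ℕ) :
    Recog (fun w i => ∃ x : ℕ → A, P (Function.update w v x) i) (2 ^ N) := by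
  classical
  obtain ⟨S, _, τ, h1, h2, h3, h4⟩ := h
  have loc : ∀ (w : Env A) (x x' : ℕ → A) i j, i ≤ j → (∀ t, i ≤ t → t < j → x t = x' t) →
      τ (Function.update w v x) i j = τ (Function.update w v x') i j := by
    intro w x x' i j hij hx
    obtain ⟨d, rfl⟩ := Nat.exists_eq_add_of_le hij
    exact h2 _ _ _ _ _ (update_loc (fun _ _ _ => rfl) (fun t ht => hx _ (by omega) (by omega)))
  refine ⟨Set S, inferInstance,
    fun w i j => {s | ∃ x, τ (Function.update w v x) i j = s}, ?_, ?_, ?_, ?_⟩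
  · rw [Fintype.card_set]; exact Nat.pow_le_pow_right (by omega) h1
  · have key : ∀ (w w' : Env A) i i' d, (∀ v t, t < d → w v (i+t) = w' v (i'+t)) →
      {s | ∃ x, τ (Function.update w v x) i (i+d) = s} ⊆
      {s | ∃ x, τ (Function.update w' v x) i' (i'+d) = s} := by
      rintro w w' i i' d h _ ⟨x, rfl⟩
      refine ⟨fun t => x (i + (t - i')), ?_⟩
      exact (h2 _ _ _ _ _ (update_loc h (fun t _ => by simp))).symm
    intro w w' i i' d h
    exact Set.Subset.antisymm (key _ _ _ _ _ h) (key _ _ _ _ _ fun v t ht => (h v t ht).symm)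
  · have key : ∀ (w w' : Env A) i j k i' j' k', i ≤ j → j ≤ k → i' ≤ j' → j' ≤ k' →
      {s | ∃ x, τ (Function.update w v x) i j = s} = {s | ∃ x, τ (Function.update w' v x) i' j' = s} →
      {s | ∃ x, τ (Function.update w v x) j k = s} = {s | ∃ x, τ (Function.update w' v x) j' k' = s} →
      {s | ∃ x, τ (Function.update w v x) i k = s} ⊆ {s | ∃ x, τ (Function.update w' v x) i' k' = s} := by
      rintro w w' i j k i' j' k' a1 a2 a3 a4 e1 e2 _ ⟨x, rfl⟩
      obtain ⟨x1, hx1⟩ := e1.subset ⟨x, rfl⟩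
      obtain ⟨x2, hx2⟩ := e2.subset ⟨x, rfl⟩
      refine ⟨fun t => if t < j' then x1 t else x2 t, ?_⟩
      refine h3 _ _ i' j' k' i j k a3 a4 a1 a2 ?_ ?_
      · rw [← hx1]
        exact loc _ _ _ _ _ a3 (fun t _ ht => by simp [ht])
      · rw [← hx2]
        exact loc _ _ _ _ _ a4 (fun t ht _ => by simp [Nat.not_lt.2 ht])
    intro w w' i j k i' j' k' a1 a2 a3 a4 e1 e2
    exact Set.Subset.antisymm (key _ _ _ _ _ _ _ _ a1 a2 a3 a4 e1 e2)
      (key _ _ _ _ _ _ _ _ a3 a4 a1 a2 e1.symm e2.symm)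
  · have key : ∀ (w w' : Env A) a b, StrictMono a → StrictMono b →
      (∀ n, {s | ∃ x, τ (Function.update w v x) (a n) (a (n+1)) = s} =
        {s | ∃ x, τ (Function.update w' v x) (b n) (b (n+1)) = s}) →
      (∃ x : ℕ → A, P (Function.update w v x) (a 0)) →
      (∃ x : ℕ → A, P (Function.update w' v x) (b 0)) := by
      rintro w w' a b ha hb hab ⟨x, hx⟩
      have : ∀ n, ∃ y, τ (Function.update w' v y) (b n) (b (n+1)) =
          τ (Function.update w v x) (a n) (a (n+1)) := fun n => (hab n).subset ⟨x, rfl⟩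
      choose y hy using this
      have : ∀ t, ∃ n, b 0 ≤ t → b n ≤ t ∧ t < b (n+1) := by
        intro t
        by_cases ht : b 0 ≤ t
        · obtain ⟨n, hn⟩ := exists_block hb ht
          exact ⟨n, fun _ => hn⟩
        · exact ⟨0, fun h => absurd h ht⟩
      choose B hB using this
      refine ⟨fun t => y (B t) t, ?_⟩
      rw [← h4 _ _ a b ha hb ?_]
      · exact hx
      · intro n
        rw [← hy n]
        refine loc _ _ _ _ _ (hb.monotone (by omega)) ?_
        intro t ht1 ht2
        have h5 := hB t ((hb.monotone (Nat.zero_le n)).trans ht1)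
        have : B t = n := by
          rcases lt_trichotomy (B t) n with h | h | h
          · have := hb.monotone (show B t + 1 ≤ n by omega); omega
          · exact h
          · have := hb.monotone (show n + 1 ≤ B t by omega); omega
        simp [this]
    intro w w' a b ha hb hab
    exact propext ⟨key _ _ _ _ ha hb hab, key _ _ _ _ hb ha fun n => (hab n).symm⟩

/-- The three components of the type used for the until operator. -/
def uType {A S : Type} (τ : Env A → ℕ → ℕ → S) (w : Env A) (i j : ℕ) :
    S × Set S × Set (S × Set S) :=
  (τ w i j, {s | ∃ l, i ≤ l ∧ l < j ∧ τ w l j = s},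
    {p | ∃ k, i ≤ k ∧ k < j ∧ τ w k j = p.1 ∧ {s | ∃ l, i ≤ l ∧ l < k ∧ τ w l j = s} = p.2})

theorem Recog.until {A : Type} {P : Env A → ℕ → Prop × Prop} {N : ℕ} (h : Recog P N) :
    Recog (fun w i => ∃ k, i ≤ k ∧ (P w k).2 ∧ ∀ j, i ≤ j → j < k → (P w j).1)
      (N * (2 ^ N * 2 ^ (N * 2 ^ N))) := by
  classical
  obtain ⟨S, _, τ, h1, h2, h3, h4⟩ := h
  refine ⟨S × Set S × Set (S × Set S), inferInstance, uType τ, ?_, ?_, ?_, ?_⟩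
  · rw [Fintype.card_prod, Fintype.card_prod, Fintype.card_set, Fintype.card_set,
      Fintype.card_prod, Fintype.card_set]
    gcongr <;> omega
  · intro w w' i i' d h
    have e : ∀ t, t ≤ d → τ w (i+t) (i+d) = τ w' (i'+t) (i'+d) := by
      intro t ht
      have := h2 w w' (i+t) (i'+t) (d-t) (by
        intro v s hs
        rw [Nat.add_assoc, Nat.add_assoc]; exact h v _ (by omega))
      rwa [show i + t + (d - t) = i + d by omega, show i' + t + (d - t) = i' + d by omega] at this
    have e2 : ∀ t, t ≤ d → {s | ∃ l, i ≤ l ∧ l < i + t ∧ τ w l (i+d) = s} =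
        {s | ∃ l, i' ≤ l ∧ l < i' + t ∧ τ w' l (i'+d) = s} := by
      intro t ht
      ext s
      constructor
      · rintro ⟨l, l1, l2, rfl⟩
        obtain ⟨r, rfl⟩ := Nat.exists_eq_add_of_le l1
        exact ⟨i' + r, by omega, by omega, (e r (by omega)).symm⟩
      · rintro ⟨l, l1, l2, rfl⟩
        obtain ⟨r, rfl⟩ := Nat.exists_eq_add_of_le l1
        exact ⟨i + r, by omega, by omega, (e r (by omega))⟩
    unfold uType
    simp only [Prod.mk.injEq]
    refine ⟨by simpa using e 0 (by omega), e2 d le_rfl, ?_⟩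
    ext ⟨s, X⟩
    constructor
    · rintro ⟨l, l1, l2, l3, l4⟩
      obtain ⟨r, rfl⟩ := Nat.exists_eq_add_of_le l1
      exact ⟨i' + r, by omega, by omega, (e r (by omega)).symm.trans l3,
        (e2 r (by omega)).symm.trans l4⟩
    · rintro ⟨l, l1, l2, l3, l4⟩
      obtain ⟨r, rfl⟩ := Nat.exists_eq_add_of_le l1
      exact ⟨i + r, by omega, by omega, (e r (by omega)).trans l3,
        (e2 r (by omega)).trans l4⟩
  · have key : ∀ (w w' : Env A) i j k i' j' k', i ≤ j → j ≤ k → i' ≤ j' → j' ≤ k' →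
      uType τ w i j = uType τ w' i' j' → uType τ w j k = uType τ w' j' k' →
      (uType τ w i k).2.1 ⊆ (uType τ w' i' k').2.1 ∧
      (uType τ w i k).2.2 ⊆ (uType τ w' i' k').2.2 := by
      intro w w' i j k i' j' k' a1 a2 a3 a4 e1 e2
      unfold uType at e1 e2
      simp only [Prod.mk.injEq] at e1 e2
      obtain ⟨e1, f1, g1⟩ := e1
      obtain ⟨e2, f2, g2⟩ := e2
      -- extension of a first part
      have ext1 : ∀ l l', l ≤ j → l' ≤ j' → τ w l j = τ w' l' j' → τ w l k = τ w' l' k' :=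
        fun l l' q1 q2 q3 => h3 w w' l j k l' j' k' q1 a2 q2 a4 q3 e2
      have full : ∀ s, (∃ l, i ≤ l ∧ l < j ∧ τ w l k = s) ↔
          ∃ l, i' ≤ l ∧ l < j' ∧ τ w' l k' = s := by
        intro s
        constructor
        · rintro ⟨l, l1, l2, rfl⟩
          obtain ⟨l', q1, q2, q3⟩ := f1.subset ⟨l, l1, l2, rfl⟩
          exact ⟨l', q1, q2, (ext1 l l' l2.le q2.le q3.symm).symm⟩
        · rintro ⟨l, l1, l2, rfl⟩
          obtain ⟨l', q1, q2, q3⟩ := f1.symm.subset ⟨l, l1, l2, rfl⟩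
          exact ⟨l', q1, q2, (ext1 l' l q2.le l2.le q3)⟩
      constructor
      · rintro s ⟨l, l1, l2, l3⟩
        by_cases hl : l < j
        · obtain ⟨l', q1, q2, q3⟩ := (full s).1 ⟨l, l1, hl, l3⟩
          exact ⟨l', q1, by omega, q3⟩
        · obtain ⟨l', q1, q2, q3⟩ := f2.subset ⟨l, by omega, l2, l3⟩
          exact ⟨l', by omega, q2, q3⟩
      · rintro ⟨s, X⟩ ⟨l, l1, l2, l3, l4⟩
        dsimp only at l3 l4
        by_cases hl : l < j
        · obtain ⟨l', q1, q2, q3, q4⟩ := g1.subset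
            (show (τ w l j, {s | ∃ r, i ≤ r ∧ r < l ∧ τ w r j = s}) ∈ _ from ⟨l, l1, hl, rfl, rfl⟩)
          dsimp only at q3 q4
          refine ⟨l', q1, by omega, ?_, ?_⟩
          · dsimp only
            rw [← l3]; exact (ext1 l l' hl.le q2.le q3.symm).symm
          · dsimp only
            rw [← l4]
            ext s
            constructor
            · rintro ⟨r, r1, r2, rfl⟩
              obtain ⟨r', p1, p2, p3⟩ := q4.subset ⟨r, r1, r2, rfl⟩
              exact ⟨r', p1, p2, ext1 r' r (by omega) (by omega) p3⟩
            · rintro ⟨r, r1, r2, rfl⟩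
              obtain ⟨r', p1, p2, p3⟩ := q4.symm.subset ⟨r, r1, r2, rfl⟩
              exact ⟨r', p1, p2, (ext1 r r' (by omega) (by omega) p3.symm).symm⟩
        · obtain ⟨l', q1, q2, q3, q4⟩ := g2.subset
            (show (τ w l k, {s | ∃ r, j ≤ r ∧ r < l ∧ τ w r k = s}) ∈ _ from
              ⟨l, by omega, l2, rfl, rfl⟩)
          dsimp only at q3 q4
          refine ⟨l', by omega, q2, q3.trans l3, ?_⟩
          dsimp only
          rw [← l4]
          ext s
          constructor
          · rintro ⟨r, r1, r2, r3⟩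
            by_cases hr : r < j'
            · obtain ⟨r', p1, p2, p3⟩ := (full s).2 ⟨r, r1, hr, r3⟩
              exact ⟨r', p1, by omega, p3⟩
            · obtain ⟨r', p1, p2, p3⟩ := q4.subset ⟨r, by omega, r2, r3⟩
              exact ⟨r', by omega, p2, p3⟩
          · rintro ⟨r, r1, r2, r3⟩
            by_cases hr : r < j
            · obtain ⟨r', p1, p2, p3⟩ := (full s).1 ⟨r, r1, hr, r3⟩
              exact ⟨r', p1, by omega, p3⟩
            · obtain ⟨r', p1, p2, p3⟩ := q4.symm.subset ⟨r, by omega, r2, r3⟩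
              exact ⟨r', by omega, p2, p3⟩
    intro w w' i j k i' j' k' a1 a2 a3 a4 e1 e2
    obtain ⟨k1, k2⟩ := key w w' i j k i' j' k' a1 a2 a3 a4 e1 e2
    obtain ⟨k3, k4⟩ := key w' w i' j' k' i j k a3 a4 a1 a2 e1.symm e2.symm
    refine Prod.ext ?_ (Prod.ext (Set.Subset.antisymm k1 k3) (Set.Subset.antisymm k2 k4))
    exact h3 w w' i j k i' j' k' a1 a2 a3 a4 (congrArg Prod.fst e1) (congrArg Prod.fst e2)
  · have key : ∀ (w w' : Env A) a b, StrictMono a → StrictMono b →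
      (∀ n, uType τ w (a n) (a (n+1)) = uType τ w' (b n) (b (n+1))) →
      (∃ k, a 0 ≤ k ∧ (P w k).2 ∧ ∀ j, a 0 ≤ j → j < k → (P w j).1) →
      (∃ k, b 0 ≤ k ∧ (P w' k).2 ∧ ∀ j, b 0 ≤ j → j < k → (P w' j).1) := by
      rintro w w' a b ha hb hab ⟨k, k1, k2, k3⟩
      have hab1 : ∀ n, τ w (a n) (a (n+1)) = τ w' (b n) (b (n+1)) :=
        fun n => congrArg Prod.fst (hab n)
      have hab2 : ∀ n, (uType τ w (a n) (a (n+1))).2.1 = (uType τ w' (b n) (b (n+1))).2.1 :=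
        fun n => by rw [hab n]
      have hab3 : ∀ n, (uType τ w (a n) (a (n+1))).2.2 = (uType τ w' (b n) (b (n+1))).2.2 :=
        fun n => by rw [hab n]
      obtain ⟨n, n1, n2⟩ := exists_block ha k1
      obtain ⟨k', q1, q2, q3, q4⟩ := (hab3 n).subset
        (show (τ w k (a (n+1)), {s | ∃ r, a n ≤ r ∧ r < k ∧ τ w r (a (n+1)) = s}) ∈ _ from
          ⟨k, n1, n2, rfl, rfl⟩)
      dsimp only at q3 q4
      refine ⟨k', (hb.monotone (Nat.zero_le n)).trans q1, ?_, ?_⟩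
      · rw [← sat_suffix h4 ha hb hab1 n2 q2 q3.symm]; exact k2
      · intro j j1 j2
        by_cases hj : b n ≤ j
        · obtain ⟨r, p1, p2, p3⟩ := q4.subset ⟨j, hj, j2, rfl⟩
          rw [← sat_suffix h4 ha hb hab1 (by omega : r < a (n+1)) (by omega) p3]
          exact k3 r ((ha.monotone (Nat.zero_le n)).trans p1) p2
        · obtain ⟨l, l1, l2⟩ := exists_block hb j1
          obtain ⟨r, p1, p2, p3⟩ := (hab2 l).symm.subset ⟨j, l1, l2, rfl⟩
          rw [← sat_suffix h4 ha hb hab1 p2 l2 p3]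
          refine k3 r ((ha.monotone (Nat.zero_le l)).trans p1) ?_
          have hl : l + 1 ≤ n := by
            by_contra hcon
            have := hb.monotone (show n ≤ l by omega)
            omega
          have := ha.monotone hl
          omega
    intro w w' a b ha hb hab
    exact propext ⟨key _ _ _ _ ha hb hab, key _ _ _ _ hb ha fun n => (hab n).symm⟩

/-- An environment all of whose sequences have period `M` from position `M` on. -/
def Up {A : Type} (M : ℕ) (w : Env A) : Prop := ∀ v t, M ≤ t → w v (t + M) = w v t

theorem Up.mul {A : Type} {M : ℕ} {w : Env A} (h : Up M w) (v t k : ℕ) (ht : M ≤ t) :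
    w v (t + M * k) = w v t := by
  induction k with
  | zero => simp
  | succ k ih => rw [Nat.mul_succ, ← Nat.add_assoc, h v _ (by omega), ih]

theorem Up.dvd {A : Type} {M M' : ℕ} {w : Env A} (h : Up M w) (hd : M ∣ M') (h0 : 0 < M') :
    Up M' w := by
  obtain ⟨k, rfl⟩ := hd
  intro v t ht
  refine h.mul v t k (le_trans ?_ ht)
  exact Nat.le_mul_of_pos_right _ (Nat.pos_of_mul_pos_left h0)

theorem exists_mono_blocks {S : Type} [Finite S] (c : ℕ → ℕ → S) :
    ∃ (s : S) (g : ℕ → ℕ), StrictMono g ∧ 1 ≤ g 0 ∧ ∀ n, c (g n) (g (n+1)) = s := by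
  classical
  let U : Ultrafilter ℕ := Filter.hyperfilter ℕ
  have lim : ∀ f : ℕ → S, ∃ s, ∀ᶠ j in U, f j = s := by
    intro f
    obtain ⟨s, hs⟩ := Ultrafilter.eq_pure_of_finite (U.map f)
    refine ⟨s, ?_⟩
    have : {s} ∈ U.map f := by rw [hs]; exact Filter.mem_pure.2 rfl
    exact this
  choose f hf using fun i => lim (c i)
  obtain ⟨s, hs⟩ := lim f
  have gt : ∀ i, ∀ᶠ j in (U : Filter ℕ), i < j := by
    intro i
    have : {j | i < j} ∈ Filter.hyperfilter ℕ := by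
      apply Filter.mem_hyperfilter_of_finite_compl
      have : {j | i < j}ᶜ = Set.Iic i := by ext; simp
      rw [this]; exact Set.finite_Iic i
    exact this
  have step : ∀ i : {i // f i = s}, ∃ j : {j // f j = s}, i.1 < j.1 ∧ c i.1 j.1 = s := by
    rintro ⟨i, hi⟩
    obtain ⟨j, ⟨h1, h2⟩, h3⟩ := (((hf i).and hs).and (gt i)).exists
    exact ⟨⟨j, h2⟩, h3, h1.trans hi⟩
  choose nx hnx using step
  obtain ⟨i0, h0, h1⟩ := (hs.and (gt 0)).exists
  let g : ℕ → {i // f i = s} := fun n => Nat.rec ⟨i0, h0⟩ (fun _ x => nx x) n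
  exact ⟨s, fun n => (g n).1, strictMono_nat_of_lt_succ fun n => (hnx (g n)).1, h1,
    fun n => (hnx (g n)).2⟩

theorem shorten {A S : Type} [Fintype S] {N : ℕ} (hN : Fintype.card S ≤ N)
    {τ : Env A → ℕ → ℕ → S}
    (h2 : ∀ w w' i i' d, (∀ v t, t < d → w v (i+t) = w' v (i'+t)) →
      τ w i (i+d) = τ w' i' (i'+d))
    (h3 : ∀ w w' i j k i' j' k', i ≤ j → j ≤ k → i' ≤ j' → j' ≤ k' →
      τ w i j = τ w' i' j' → τ w j k = τ w' j' k' → τ w i k = τ w' i' k')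
    {w : Env A} {M : ℕ} (hw : Up M w) (v p : ℕ) (s : S) :
    ∀ k, 1 ≤ k → (∃ x, τ (Function.update w v x) (M*p) (M*(p+k)) = s) →
    ∃ k', 1 ≤ k' ∧ k' ≤ N ∧ ∃ x, τ (Function.update w v x) (M*p) (M*(p+k')) = s := by
  intro k
  induction k using Nat.strong_induction_on with
  | _ k ih =>
  rintro hk ⟨x, hx⟩
  by_cases hkN : k ≤ N
  · exact ⟨k, hk, hkN, x, hx⟩
  have hcard : Fintype.card S < Fintype.card (Fin k) := by rw [Fintype.card_fin]; omega
  obtain ⟨j, j', hne, heq⟩ := Fintype.exists_ne_map_eq_of_card_lt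
    (fun j : Fin k => τ (Function.update w v x) (M*p) (M*(p+(j.1+1)))) hcard
  have main : ∀ j j' : ℕ, 1 ≤ j → j < j' → j' ≤ k →
      τ (Function.update w v x) (M*p) (M*(p+j)) = τ (Function.update w v x) (M*p) (M*(p+j')) →
      ∃ k', 1 ≤ k' ∧ k' ≤ N ∧ ∃ x, τ (Function.update w v x) (M*p) (M*(p+k')) = s := by
    intro j j' q1 q2 q3 q4
    refine ih (k - (j' - j)) (by omega) (by omega) ⟨fun t => if t < M*(p+j) then x t else
      x (t + M*(j'-j)), ?_⟩
    rw [← hx]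
    refine h3 _ _ (M*p) (M*(p+j)) _ (M*p) (M*(p+j')) _ (Nat.mul_le_mul_left _ (by omega))
      (Nat.mul_le_mul_left _ (by omega)) (Nat.mul_le_mul_left _ (by omega))
      (Nat.mul_le_mul_left _ (by omega)) ?_ ?_
    · rw [← q4]
      have e : M*(p+j) = M*p + M*j := by ring
      rw [e]
      refine h2 _ _ _ _ _ (update_loc (fun _ _ _ => rfl) ?_)
      intro t ht
      simp [ht]
    · have e : M*(p+(k-(j'-j))) = M*(p+j) + M*(k-j') := by
        rw [← Nat.mul_add]; congr 1; omega
      have e' : M*(p+k) = M*(p+j') + M*(k-j') := by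
        rw [← Nat.mul_add]; congr 1; omega
      rw [e, e']
      have e3 : M*(p+j') = M*(p+j) + M*(j'-j) := by
        rw [← Nat.mul_add]; congr 1; omega
      refine h2 _ _ _ _ _ (update_loc ?_ ?_)
      · intro u t _
        rw [e3, show M*(p+j) + M*(j'-j) + t = M*(p+j) + t + M*(j'-j) by omega]
        refine (hw.mul u _ _ ?_).symm
        have : M * 1 ≤ M*(p+j) := Nat.mul_le_mul_left _ (by omega)
        omega
      · intro t _
        have : ¬ (M*(p+j) + t < M*(p+j)) := by omega
        simp only [this, if_false]
        congr 1; omega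
  rcases Nat.lt_trichotomy j.1 j'.1 with h | h | h
  · exact main (j.1+1) (j'.1+1) (by omega) (by omega) (by omega) heq
  · exact absurd (Fin.ext h) hne
  · exact main (j'.1+1) (j.1+1) (by omega) (by omega) (by omega) heq.symm

/-- Every witness can be replaced by an ultimately periodic one of bounded size. -/
theorem Recog.pump {A : Type} {P : Env A → ℕ → Prop} {N : ℕ} (h : Recog P N)
    {w : Env A} {M : ℕ} (hM : 0 < M) (hw : Up M w) (v : ℕ) (x : ℕ → A)
    (hx : P (Function.update w v x) 0) :
    ∃ x' : ℕ → A, P (Function.update w v x') 0 ∧ Up (M * N.factorial) (Function.update w v x') := by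
  obtain ⟨S, _, τ, h1, h2, h3, h4⟩ := h
  obtain ⟨s, g, hg, hg0, hgs⟩ := exists_mono_blocks
    (fun i j => τ (Function.update w v x) (M*i) (M*j))
  obtain ⟨k0, k01, k02, x0, hx0⟩ := shorten h1 h2 h3 hw v 0
    (τ (Function.update w v x) 0 (M*(g 0))) (g 0) hg0 ⟨x, by simp⟩
  have hg1 := hg (show 0 < 1 by omega)
  obtain ⟨k1, k11, k12, x1, hx1⟩ := shorten h1 h2 h3 hw v (g 0) s (g 1 - g 0) (by omega) ⟨x, by
    rw [show g 0 + (g 1 - g 0) = g 1 by omega]; exact hgs 0⟩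
  simp only [Nat.zero_add, Nat.mul_zero] at hx0
  have hMk1 : 0 < M * k1 := Nat.mul_pos hM (by omega)
  have hMk0 : M ≤ M * k0 := Nat.le_mul_of_pos_right _ (by omega)
  have hMg0 : M ≤ M * g 0 := Nat.le_mul_of_pos_right _ (by omega)
  let x' : ℕ → A := fun t => if t < M*k0 then x0 t else x1 (M * g 0 + (t - M*k0) % (M*k1))
  have hper : ∀ t, M * k0 ≤ t → x' (t + M * k1) = x' t := by
    intro t ht
    have q1 : ¬ (t < M*k0) := by omega
    have q2 : ¬ (t + M*k1 < M*k0) := by omega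
    simp only [x', q1, q2, if_false]
    rw [show t + M*k1 - M*k0 = t - M*k0 + M*k1 by omega, Nat.add_mod_right]
  refine ⟨x', ?_, ?_⟩
  · have hmul : StrictMono (fun n => M * g n) := fun a b hab => Nat.mul_lt_mul_of_pos_left (hg hab) hM
    have hb : StrictMono (fun n => M * k0 + M * k1 * n) := by
      refine strictMono_nat_of_lt_succ fun n => ?_
      rw [Nat.mul_succ]; omega
    let a' : ℕ → ℕ := fun j => Nat.casesOn j 0 (fun j => M * g j)
    let b' : ℕ → ℕ := fun j => Nat.casesOn j 0 (fun j => M * k0 + M * k1 * j)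
    have ha' : StrictMono a' := by
      refine strictMono_nat_of_lt_succ ?_
      rintro (_ | j)
      · show 0 < M * g 0
        omega
      · exact hmul (Nat.lt_succ_self j)
    have hb' : StrictMono b' := by
      refine strictMono_nat_of_lt_succ ?_
      rintro (_ | j)
      · show 0 < M * k0 + M * k1 * 0
        omega
      · exact hb (Nat.lt_succ_self j)
    have := h4 (Function.update w v x) (Function.update w v x') a' b' ha' hb' ?_
    · have e : P (Function.update w v x) 0 = P (Function.update w v x') 0 := this
      rwa [← e]
    · rintro (_ | j)
      · show τ _ 0 (M * g 0) = τ _ 0 (M*k0 + M*k1*0)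
        rw [← hx0, Nat.mul_zero, Nat.add_zero]
        have := h2 (Function.update w v x0) (Function.update w v x') 0 0 (M*k0)
          (update_loc (fun _ _ _ => rfl) (fun t ht => by simp [x', ht]))
        simpa using this
      · show τ _ (M * g j) (M * g (j+1)) = τ _ (M*k0 + M*k1*j) (M*k0 + M*k1*(j+1))
        refine (hgs j).trans ?_
        rw [← hx1, Nat.mul_add, Nat.mul_succ, ← Nat.add_assoc]
        refine h2 _ _ _ _ _ (update_loc ?_ ?_)
        · intro u t ht
          have e1 := hw.mul u (M * g 0 + t) (k0 + k1*j) (by omega)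
          have e2 := hw.mul u (M*k0 + M*k1*j + t) (g 0) (by omega)
          rw [← e1, ← e2]
          congr 1; ring
        · intro t ht
          have q : ¬ (M*k0 + M*k1*j + t < M*k0) := by omega
          simp only [x', q, if_false]
          rw [show M*k0 + M*k1*j + t - M*k0 = t + M*k1*j by omega, Nat.add_mul_mod_self_left,
            Nat.mod_eq_of_lt ht]
  · have hN0 : 0 < N.factorial := Nat.factorial_pos N
    have hperk : ∀ k t, M * k0 ≤ t → x' (t + M * k1 * k) = x' t := by
      intro k
      induction k with
      | zero => intro t _; simp
      | succ k ih =>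
        intro t ht
        rw [Nat.mul_succ, ← Nat.add_assoc, hper _ (by omega), ih t ht]
    intro u t ht
    by_cases hu : u = v
    · subst hu
      simp only [Function.update_self]
      obtain ⟨r, hr⟩ := Nat.dvd_factorial (by omega : 0 < k1) k12
      rw [hr, ← Nat.mul_assoc]
      refine hperk r t (le_trans ?_ ht)
      exact Nat.mul_le_mul_left _ (k02.trans (Nat.self_le_factorial N))
    · simp only [Function.update_of_ne hu]
      exact hw.dvd (Dvd.intro _ rfl) (Nat.mul_pos hM hN0) u t ht

end HQ
namespace HQ

/-! ### Semantics over environments -/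

def labL (K : FinKripke) (c : ℕ) : Set ℕ := {a | ∃ s : Fin K.n, c = s.val + 1 ∧ a ∈ K.label s}

def PiOf {m : ℕ} (K : FinKripke) (w : Env (Fin m)) (π i : ℕ) : Set ℕ := labL K (w (2*π) i).val

def sgOf {m : ℕ} (w : Env (Fin m)) (q : ℕ) : Set ℕ := {i | (w (2*q+1) i).val ≠ 0}

def stepR (K : FinKripke) (c d : ℕ) : Prop :=
  ∃ s t : Fin K.n, c = s.val + 1 ∧ d = t.val + 1 ∧ t ∈ K.trans s

def Con {m : ℕ} (K : FinKripke) (x : ℕ → Fin m) (i : ℕ) : Prop :=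
  (x i).val = K.init.val + 1 ∧ ∀ l, i ≤ l → stepR K (x l).val (x (l+1)).val

def HS {m : ℕ} (K : FinKripke) : Env (Fin m) → ℕ → HyperQPTL → Prop
  | w, i, .qf ψ => QF.Sat (PiOf K w) (sgOf w) i ψ
  | w, i, .ex π φ => ∃ x, Con K x i ∧ HS K (Function.update w (2*π) x) i φ
  | w, i, .all π φ => ∀ x, Con K x i → HS K (Function.update w (2*π) x) i φ
  | w, i, .pex q φ => ∃ x, HS K (Function.update w (2*q+1) x) i φ
  | w, i, .pall q φ => ∀ x, HS K (Function.update w (2*q+1) x) i φ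

theorem traces_iff {m : ℕ} (K : FinKripke) (hm : K.n + 1 ≤ m) (t : Trace) :
    t ∈ K.Traces ↔ ∃ x : ℕ → Fin m, Con K x 0 ∧ t = fun i => labL K (x i).val := by
  have lab : ∀ s : Fin K.n, labL K (s.val + 1) = (K.label s : Set ℕ) := by
    intro s
    ext a
    constructor
    · rintro ⟨s', h1, h2⟩
      have : s = s' := Fin.ext (by omega)
      subst this; exact h2
    · intro h; exact ⟨s, rfl, h⟩
  constructor
  · rintro ⟨p, ⟨hp0, hp⟩, rfl⟩
    refine ⟨fun i => ⟨(p i).val + 1, by have := (p i).isLt; omega⟩, ⟨?_, ?_⟩, ?_⟩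
    · simp [hp0]
    · intro l _
      exact ⟨p l, p (l+1), rfl, rfl, hp l⟩
    · funext i; exact (lab (p i)).symm
  · rintro ⟨x, ⟨h0, h1⟩, rfl⟩
    have : ∀ l, ∃ s : Fin K.n, (x l).val = s.val + 1 := by
      intro l
      obtain ⟨s, _, hs, _⟩ := h1 l (Nat.zero_le l)
      exact ⟨s, hs⟩
    choose p hp using this
    refine ⟨p, ⟨?_, ?_⟩, ?_⟩
    · have := hp 0
      exact Fin.ext (by omega)
    · intro i
      obtain ⟨s, t, hs, ht, hst⟩ := h1 i (Nat.zero_le i)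
      have e1 : p i = s := Fin.ext (by have := hp i; omega)
      have e2 : p (i+1) = t := Fin.ext (by have := hp (i+1); omega)
      rw [e1, e2]; exact hst
    · funext i; rw [hp i, lab]

theorem PiOf_upd {m : ℕ} (K : FinKripke) (w : Env (Fin m)) (π : ℕ) (x : ℕ → Fin m) :
    PiOf K (Function.update w (2*π) x) = Function.update (PiOf K w) π (fun i => labL K (x i).val) := by
  funext ρ i
  by_cases h : ρ = π
  · subst h; simp [PiOf]
  · simp [PiOf, h]

theorem PiOf_upd' {m : ℕ} (K : FinKripke) (w : Env (Fin m)) (q : ℕ) (x : ℕ → Fin m) :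
    PiOf K (Function.update w (2*q+1) x) = PiOf K w := by
  funext ρ i
  have h : 2 * ρ ≠ 2 * q + 1 := by omega
  simp [PiOf, h]

theorem sgOf_upd {m : ℕ} (w : Env (Fin m)) (q : ℕ) (x : ℕ → Fin m) :
    sgOf (Function.update w (2*q+1) x) = Function.update (sgOf w) q {i | (x i).val ≠ 0} := by
  funext ρ
  by_cases h : ρ = q
  · subst h; simp [sgOf]
  · simp [sgOf, h]

theorem sgOf_upd' {m : ℕ} (w : Env (Fin m)) (π : ℕ) (x : ℕ → Fin m) :
    sgOf (Function.update w (2*π) x) = sgOf w := by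
  funext ρ
  have h : 2 * ρ + 1 ≠ 2 * π := by omega
  simp [sgOf, h]

theorem HS_iff {m : ℕ} (K : FinKripke) (hm : K.n + 2 ≤ m) (φ : HyperQPTL) :
    ∀ w : Env (Fin m), HS K w 0 φ ↔ HyperQPTL.Sat K.Traces (PiOf K w) (sgOf w) 0 φ := by
  classical
  have hset : ∀ s : Set ℕ, ∃ x : ℕ → Fin m, s = {i | (x i).val ≠ 0} := by
    intro s
    refine ⟨fun i => if i ∈ s then ⟨1, by omega⟩ else ⟨0, by omega⟩, ?_⟩
    ext i
    by_cases h : i ∈ s <;> simp [h]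
  induction φ with
  | qf ψ => intro w; rfl
  | ex π φ ih =>
    intro w
    simp only [HS, HyperQPTL.Sat]
    constructor
    · rintro ⟨x, h1, h2⟩
      refine ⟨_, (traces_iff K (by omega) _).2 ⟨x, h1, rfl⟩, ?_⟩
      rw [ih, PiOf_upd, sgOf_upd'] at h2
      exact h2
    · rintro ⟨t, h1, h2⟩
      obtain ⟨x, hx, rfl⟩ := (traces_iff K (by omega : K.n + 1 ≤ m) _).1 h1
      refine ⟨x, hx, ?_⟩
      rw [ih, PiOf_upd, sgOf_upd']
      exact h2
  | all π φ ih =>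
    intro w
    simp only [HS, HyperQPTL.Sat]
    constructor
    · rintro h t h1
      obtain ⟨x, hx, rfl⟩ := (traces_iff K (by omega : K.n + 1 ≤ m) _).1 h1
      have := h x hx
      rw [ih, PiOf_upd, sgOf_upd'] at this
      exact this
    · intro h x hx
      rw [ih, PiOf_upd, sgOf_upd']
      exact h _ ((traces_iff K (by omega) _).2 ⟨x, hx, rfl⟩)
  | pex q φ ih =>
    intro w
    simp only [HS, HyperQPTL.Sat]
    constructor
    · rintro ⟨x, h2⟩
      rw [ih, PiOf_upd', sgOf_upd] at h2
      exact ⟨_, h2⟩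
    · rintro ⟨s, h2⟩
      obtain ⟨x, rfl⟩ := hset s
      refine ⟨x, ?_⟩
      rw [ih, PiOf_upd', sgOf_upd]
      exact h2
  | pall q φ ih =>
    intro w
    simp only [HS, HyperQPTL.Sat]
    constructor
    · rintro h s
      obtain ⟨x, rfl⟩ := hset s
      have := h x
      rw [ih, PiOf_upd', sgOf_upd] at this
      exact this
    · intro h x
      rw [ih, PiOf_upd', sgOf_upd]
      exact h _

/-! ### Bounds on the number of types -/

def G (N : ℕ) : ℕ := N * (2 ^ N * 2 ^ (N * 2 ^ N))

def F (N : ℕ) : ℕ := G (N * N + N)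

def B0 (m : ℕ) : ℕ := (m+1) * G ((m+1) * ((m+1) * (m+1+1)))

def Bd (m c : ℕ) : ℕ := F^[c] (B0 m)

theorem le_G (N : ℕ) : N ≤ G N := by
  unfold G
  exact Nat.le_mul_of_pos_right _ (by positivity)

theorem G_mono {N N' : ℕ} (h : N ≤ N') : G N ≤ G N' := by
  unfold G; gcongr <;> omega

theorem pow_le_G {N : ℕ} (h : 0 < N) : 2 ^ N ≤ G N := by
  unfold G
  calc 2 ^ N ≤ 2 ^ N * 2 ^ (N * 2 ^ N) := Nat.le_mul_of_pos_right _ (by positivity)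
    _ ≤ _ := Nat.le_mul_of_pos_left _ h

theorem le_F (N : ℕ) : N ≤ F N := le_trans (by omega) (le_G _)

theorem Bd_mono (m : ℕ) : Monotone (Bd m) := by
  refine monotone_nat_of_le_succ fun n => ?_
  unfold Bd
  rw [Function.iterate_succ_apply']
  exact le_F _

theorem F_Bd_le {m c c' : ℕ} (h : c < c') : F (Bd m c) ≤ Bd m c' := by
  refine le_trans ?_ (Bd_mono m h)
  unfold Bd
  rw [Nat.succ_eq_add_one, Function.iterate_succ_apply']

theorem B0_le (m c : ℕ) : B0 m ≤ Bd m c := Bd_mono m (Nat.zero_le c)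

theorem lt_B0 (m : ℕ) : m + 1 ≤ B0 m := by
  unfold B0
  refine Nat.le_mul_of_pos_right _ (lt_of_lt_of_le ?_ (le_G _))
  positivity

theorem Bd_pos (m c : ℕ) : 0 < Bd m c :=
  lt_of_lt_of_le (Nat.succ_pos m) ((lt_B0 m).trans (B0_le m c))

theorem Recog.congr {A β : Type} {P Q : Env A → ℕ → β} {N : ℕ} (h : Recog P N)
    (e : ∀ w i, P w i = Q w i) : Recog Q N := by
  have : P = Q := by funext w i; exact e w i
  rwa [← this]

theorem recog_con {m : ℕ} (K : FinKripke) (v : ℕ) :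
    Recog (fun (w : Env (Fin m)) i => Con K (w v) i) (B0 m) := by
  have h1 : Recog (fun (w : Env (Fin m)) i => w v i) (m + 1) := by
    have := Recog.letter (A := Fin m) v
    rwa [Fintype.card_fin] at this
  have h2 := h1.pair h1.next
  have h3 := (h2.map (fun p => ((True : Prop), ¬ stepR K p.1.val p.2.val))).until
  refine ((h1.pair h3).map (fun p => p.1.val = K.init.val + 1 ∧ ¬ p.2)).congr ?_
  intro w i
  simp only [Con, eq_iff_iff]
  refine and_congr Iff.rfl ?_
  simp

theorem recog_QF {m : ℕ} (K : FinKripke) (ψ : QF) :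
    Recog (fun (w : Env (Fin m)) i => QF.Sat (PiOf K w) (sgOf w) i ψ) (Bd m ψ.enc) := by
  have h1 : ∀ v, Recog (fun (w : Env (Fin m)) i => w v i) (m + 1) := by
    intro v
    have := Recog.letter (A := Fin m) v
    rwa [Fintype.card_fin] at this
  have hb : ∀ c, m + 1 ≤ Bd m c := fun c => (lt_B0 m).trans (B0_le m c)
  induction ψ with
  | atom a π =>
    exact (((h1 (2*π)).map (fun c => a ∈ labL K c.val)).mono (hb _)).congr fun w i => rfl
  | patom q =>
    exact (((h1 (2*q+1)).map (fun c => c.val ≠ 0)).mono (hb _)).congr fun w i => rfl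
  | not ψ ih =>
    exact ((ih.map (fun p => ¬ p)).mono (Bd_mono m (Nat.right_le_pair _ _))).congr fun w i => rfl
  | and ψ₁ ψ₂ ih1 ih2 =>
    have e1 : ψ₁.enc ≤ Nat.pair ψ₁.enc ψ₂.enc := Nat.left_le_pair _ _
    have e2 : ψ₂.enc ≤ Nat.pair ψ₁.enc ψ₂.enc := Nat.right_le_pair _ _
    have e3 := Nat.add_le_pair 3 (Nat.pair ψ₁.enc ψ₂.enc)
    refine ((((ih1.mono (Bd_mono m e1)).pair (ih2.mono (Bd_mono m e2))).map
      (fun p => p.1 ∧ p.2)).mono ?_).congr fun w i => rfl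
    refine le_trans ?_ (F_Bd_le (show Nat.pair ψ₁.enc ψ₂.enc < _ by simp only [QF.enc]; omega))
    exact le_trans (by omega) (le_G _)
  | next ψ ih =>
    have e3 := Nat.add_le_pair 4 ψ.enc
    refine (ih.next.mono ?_).congr fun w i => rfl
    refine le_trans ?_ (F_Bd_le (show ψ.enc < _ by simp only [QF.enc]; omega))
    exact le_trans (le_of_eq (by ring)) (le_G _)
  | xuntil ψ₁ ψ₂ ih1 ih2 =>
    have e1 : ψ₁.enc ≤ Nat.pair ψ₁.enc ψ₂.enc := Nat.left_le_pair _ _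
    have e2 : ψ₂.enc ≤ Nat.pair ψ₁.enc ψ₂.enc := Nat.right_le_pair _ _
    have e3 := Nat.add_le_pair 5 (Nat.pair ψ₁.enc ψ₂.enc)
    refine ((((ih1.mono (Bd_mono m e1)).pair (ih2.mono (Bd_mono m e2))).until).mono ?_).congr
      fun w i => rfl
    refine le_trans ?_ (F_Bd_le (show Nat.pair ψ₁.enc ψ₂.enc < _ by simp only [QF.enc]; omega))
    exact G_mono (by omega)

theorem recog_body {m : ℕ} {K : FinKripke} {P : Env (Fin m) → ℕ → Prop} {c : ℕ}
    (h : Recog P (Bd m c)) (v : ℕ) :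
    Recog (fun w i => Con K (w v) i ∧ P w i) (Bd m c * Bd m c) :=
  ((((recog_con K v).mono (B0_le m c)).pair h).map (fun p => p.1 ∧ p.2)).congr fun w i => rfl

theorem sq_le {m c c' : ℕ} (h : c < c') : 2 ^ (Bd m c * Bd m c) ≤ Bd m c' := by
  refine le_trans ?_ (F_Bd_le h)
  have := Bd_pos m c
  exact le_trans (pow_le_G (Nat.mul_pos this this)) (G_mono (by omega))

theorem sq_le' {m c c' : ℕ} (h : c < c') : Bd m c * Bd m c ≤ Bd m c' :=
  le_trans (Nat.lt_two_pow_self).le (sq_le h)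

theorem pow_le {m c c' : ℕ} (h : c < c') : 2 ^ (Bd m c) ≤ Bd m c' :=
  le_trans (Nat.pow_le_pow_right (by omega) (Nat.le_mul_of_pos_left _ (Bd_pos m c))) (sq_le h)

theorem enc_lt {t v c : ℕ} (h : 1 ≤ t) : c < Nat.pair t (Nat.pair v c) := by
  have := Nat.add_le_pair t (Nat.pair v c)
  have := Nat.right_le_pair v c
  omega

theorem recog_HS {m : ℕ} (K : FinKripke) (φ : HyperQPTL) :
    Recog (fun (w : Env (Fin m)) i => HS K w i φ) (Bd m φ.enc) := by
  induction φ with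
  | qf ψ => exact ((recog_QF K ψ).mono (Bd_mono m (Nat.right_le_pair _ _))).congr fun w i => rfl
  | ex π φ ih =>
    refine (((recog_body (K := K) ih (2*π)).ex (2*π)).mono (sq_le (enc_lt (by omega)))).congr ?_
    intro w i
    simp [HS]
  | all π φ ih =>
    refine ((((recog_body (K := K) (ih.map (fun p => ¬ p)) (2*π)).ex (2*π)).map
      (fun p => ¬ p)).mono (sq_le (enc_lt (by omega)))).congr ?_
    intro w i
    simp [HS]
  | pex q φ ih =>
    refine ((ih.ex (2*q+1)).mono (pow_le (enc_lt (by omega)))).congr ?_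
    intro w i
    simp [HS]
  | pall q φ ih =>
    refine ((((ih.map (fun p => ¬ p)).ex (2*q+1)).map
      (fun p => ¬ p)).mono (pow_le (enc_lt (by omega)))).congr ?_
    intro w i
    simp [HS]

end HQ
namespace HQ

/-! ### The algorithm -/

def pm (n : ℕ) : ℕ := n.unpair.1.unpair.1 + 2
def pinit (n : ℕ) : ℕ := n.unpair.1.unpair.2.unpair.1
def ptr (n : ℕ) : List (List ℕ) :=
  (Encodable.decode (α := List (List ℕ)) n.unpair.1.unpair.2.unpair.2.unpair.1).getD []
def plb (n : ℕ) : List (List ℕ) :=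
  (Encodable.decode (α := List (List ℕ)) n.unpair.1.unpair.2.unpair.2.unpair.2).getD []
def pC (n : ℕ) : ℕ := n.unpair.2
def pN (n : ℕ) : ℕ := Bd (pm n) (pC n)
def pU (n : ℕ) : ℕ := (pN n).factorial
def lev (n c : ℕ) : ℕ := pU n ^ (pC n + 1 - c)
def pL (n : ℕ) : ℕ := lev n 0
def pBx (n : ℕ) : ℕ := Nat.pair (2 * pC n + 2) (2 * pL n)
def pBnd (n : ℕ) : ℕ := pm n ^ pBx n

def fold (L i : ℕ) : ℕ := if i < L then i else L + i % L
def dig (m e k : ℕ) : ℕ := e / m ^ k % m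
/-- The letter of variable `v` at position `i` in the environment coded by `e`. -/
def ltr (n e v i : ℕ) : ℕ := dig (pm n) e (Nat.pair v (fold (pL n) i))
def inRow (l : List (List ℕ)) (c a : ℕ) : Prop := 0 < c ∧ ∃ b ∈ l.getD (c-1) [], b = a
def hasLab (n a c : ℕ) : Prop := inRow (plb n) c a
def hasTr (n c d : ℕ) : Prop := 0 < d ∧ inRow (ptr n) c (d-1)

def TQ (T c e i : ℕ) : Prop := dig 2 T (Nat.pair 1 (Nat.pair c (Nat.pair e i))) = 1
def TH (T c e : ℕ) : Prop := dig 2 T (Nat.pair 0 (Nat.pair c e)) = 1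

def ruleQ (n : ℕ) (t : ℕ → ℕ → ℕ → Prop) (c e i : ℕ) : Prop :=
  (c.unpair.1 = 0 ∧ hasLab n c.unpair.2.unpair.1 (ltr n e (2 * c.unpair.2.unpair.2) i)) ∨
  (c.unpair.1 = 1 ∧ ¬ (ltr n e (2 * c.unpair.2 + 1) i = 0)) ∨
  (c.unpair.1 = 2 ∧ ¬ (c.unpair.2 < c ∧ t c.unpair.2 e i)) ∨
  (c.unpair.1 = 3 ∧ (c.unpair.2.unpair.1 < c ∧ t c.unpair.2.unpair.1 e i) ∧
    (c.unpair.2.unpair.2 < c ∧ t c.unpair.2.unpair.2 e i)) ∨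
  (c.unpair.1 = 4 ∧ (c.unpair.2 < c ∧ t c.unpair.2 e (fold (pL n) (i+1)))) ∨
  (c.unpair.1 = 5 ∧ ∃ k < i + 2 * pL n + 1, ¬ (k < i) ∧
    (c.unpair.2.unpair.2 < c ∧ t c.unpair.2.unpair.2 e (fold (pL n) k)) ∧
    ∀ j < k, j < i ∨ (c.unpair.2.unpair.1 < c ∧ t c.unpair.2.unpair.1 e (fold (pL n) j)))

def agree (n v e e' : ℕ) : Prop :=
  ∀ k < pBx n, k.unpair.1 = v ∨ dig (pm n) e' k = dig (pm n) e k

def isUp (n v c e' : ℕ) : Prop :=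
  ∀ l < 2 * pL n, l < lev n c ∨ ltr n e' v (l + lev n c) = ltr n e' v l

def isCon (n v e' : ℕ) : Prop :=
  ltr n e' v 0 = pinit n + 1 ∧ ∀ l < 2 * pL n, hasTr n (ltr n e' v l) (ltr n e' v (l+1))

def ruleH (n : ℕ) (t1 : ℕ → ℕ → ℕ → Prop) (t : ℕ → ℕ → Prop) (c e : ℕ) : Prop :=
  (c.unpair.1 = 0 ∧ t1 c.unpair.2 e 0) ∨
  (c.unpair.1 = 1 ∧ ∃ e' < pBnd n, (agree n (2 * c.unpair.2.unpair.1) e e' ∧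
    isUp n (2 * c.unpair.2.unpair.1) c.unpair.2.unpair.2 e' ∧
    isCon n (2 * c.unpair.2.unpair.1) e') ∧
    (c.unpair.2.unpair.2 < c ∧ t c.unpair.2.unpair.2 e')) ∨
  (c.unpair.1 = 2 ∧ ∀ e' < pBnd n, ¬ (agree n (2 * c.unpair.2.unpair.1) e e' ∧
    isUp n (2 * c.unpair.2.unpair.1) c.unpair.2.unpair.2 e' ∧
    isCon n (2 * c.unpair.2.unpair.1) e') ∨
    (c.unpair.2.unpair.2 < c ∧ t c.unpair.2.unpair.2 e')) ∨
  (c.unpair.1 = 3 ∧ ∃ e' < pBnd n, (agree n (2 * c.unpair.2.unpair.1 + 1) e e' ∧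
    isUp n (2 * c.unpair.2.unpair.1 + 1) c.unpair.2.unpair.2 e') ∧
    (c.unpair.2.unpair.2 < c ∧ t c.unpair.2.unpair.2 e')) ∨
  (c.unpair.1 = 4 ∧ ∀ e' < pBnd n, ¬ (agree n (2 * c.unpair.2.unpair.1 + 1) e e' ∧
    isUp n (2 * c.unpair.2.unpair.1 + 1) c.unpair.2.unpair.2 e') ∨
    (c.unpair.2.unpair.2 < c ∧ t c.unpair.2.unpair.2 e'))

def consistent (n T : ℕ) : Prop :=
  (∀ c < pC n + 1, ∀ e < pBnd n, ∀ i < 2 * pL n, (TQ T c e i ↔ ruleQ n (TQ T) c e i)) ∧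
  (∀ c < pC n + 1, ∀ e < pBnd n, (TH T c e ↔ ruleH n (TQ T) (TH T) c e))

/-! ### Primitive recursiveness -/

section prim
variable {α : Type} [Primcodable α]

theorem p_forall {p : α → ℕ → Prop} {b : α → ℕ} (hb : Primrec b)
    (hp : PrimrecPred fun x : α × ℕ => p x.1 x.2) : PrimrecPred fun a => ∀ x < b a, p a x := by
  have h : PrimrecRel (fun (x : ℕ) (a : α) => p a x) :=
    PrimrecPred.comp hp (Primrec.pair Primrec.snd Primrec.fst)
  exact ((PrimrecRel.forall_mem_list h).comp (Primrec.list_range.comp hb) Primrec.id).of_eq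
    fun a => by simp

theorem p_exists {p : α → ℕ → Prop} {b : α → ℕ} (hb : Primrec b)
    (hp : PrimrecPred fun x : α × ℕ => p x.1 x.2) : PrimrecPred fun a => ∃ x < b a, p a x := by
  have h : PrimrecRel (fun (x : ℕ) (a : α) => p a x) :=
    PrimrecPred.comp hp (Primrec.pair Primrec.snd Primrec.fst)
  exact ((PrimrecRel.exists_mem_list h).comp (Primrec.list_range.comp hb) Primrec.id).of_eq
    fun a => by simp

theorem p_iff {p q : α → Prop} (hp : PrimrecPred p) (hq : PrimrecPred q) :
    PrimrecPred fun a => (p a ↔ q a) :=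
  ((hp.and hq).or (hp.not.and hq.not)).of_eq fun a => by tauto

theorem p_eq {f g : α → ℕ} (hf : Primrec f) (hg : Primrec g) : PrimrecPred fun a => f a = g a :=
  Primrec.eq.comp hf hg

theorem p_lt {f g : α → ℕ} (hf : Primrec f) (hg : Primrec g) : PrimrecPred fun a => f a < g a :=
  Primrec.nat_lt.comp hf hg

theorem p_add {f g : α → ℕ} (hf : Primrec f) (hg : Primrec g) : Primrec fun a => f a + g a :=
  Primrec.nat_add.comp hf hg

theorem p_sub {f g : α → ℕ} (hf : Primrec f) (hg : Primrec g) : Primrec fun a => f a - g a :=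
  Primrec.nat_sub.comp hf hg

theorem p_mul {f g : α → ℕ} (hf : Primrec f) (hg : Primrec g) : Primrec fun a => f a * g a :=
  Primrec.nat_mul.comp hf hg

theorem p_div {f g : α → ℕ} (hf : Primrec f) (hg : Primrec g) : Primrec fun a => f a / g a :=
  Primrec.nat_div.comp hf hg

theorem p_mod {f g : α → ℕ} (hf : Primrec f) (hg : Primrec g) : Primrec fun a => f a % g a :=
  Primrec.nat_mod.comp hf hg

theorem p_pow {f g : α → ℕ} (hf : Primrec f) (hg : Primrec g) : Primrec fun a => f a ^ g a :=
  (Primrec₂.unpaired'.1 Nat.Primrec.pow).comp hf hg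

theorem p_pair {f g : α → ℕ} (hf : Primrec f) (hg : Primrec g) :
    Primrec fun a => Nat.pair (f a) (g a) :=
  Primrec₂.natPair.comp hf hg

theorem p_un1 {f : α → ℕ} (hf : Primrec f) : Primrec fun a => (f a).unpair.1 :=
  Primrec.fst.comp (Primrec.unpair.comp hf)

theorem p_un2 {f : α → ℕ} (hf : Primrec f) : Primrec fun a => (f a).unpair.2 :=
  Primrec.snd.comp (Primrec.unpair.comp hf)

theorem p_fact {f : α → ℕ} (hf : Primrec f) : Primrec fun a => (f a).factorial := by
  refine (Primrec.nat_rec' (f := f) (g := fun _ => 1) (h := fun _ p => (p.1 + 1) * p.2)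
    hf (Primrec.const 1) ?_).of_eq ?_
  · exact p_mul (p_add (Primrec.fst.comp Primrec.snd) (Primrec.const 1))
      (Primrec.snd.comp Primrec.snd)
  · intro a
    induction f a with
    | zero => rfl
    | succ k ih => simp only [Nat.factorial, ← ih]

theorem p_G {f : α → ℕ} (hf : Primrec f) : Primrec fun a => G (f a) := by
  unfold G
  have h2 : Primrec fun a => 2 ^ f a := p_pow (Primrec.const 2) hf
  exact p_mul hf (p_mul h2 (p_pow (Primrec.const 2) (p_mul hf h2)))

theorem p_F {f : α → ℕ} (hf : Primrec f) : Primrec fun a => F (f a) :=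
  p_G (p_add (p_mul hf hf) hf)

theorem p_B0 {f : α → ℕ} (hf : Primrec f) : Primrec fun a => B0 (f a) := by
  have h := p_add hf (Primrec.const 1)
  exact p_mul h (p_G (p_mul h (p_mul h (p_add h (Primrec.const 1)))))

theorem p_Bd {f g : α → ℕ} (hf : Primrec f) (hg : Primrec g) : Primrec fun a => Bd (f a) (g a) :=
  Primrec.nat_iterate hg (p_B0 hf) (p_F Primrec.snd)

theorem p_pm {f : α → ℕ} (hf : Primrec f) : Primrec fun a => pm (f a) :=
  p_add (p_un1 (p_un1 hf)) (Primrec.const 2)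

theorem p_pinit {f : α → ℕ} (hf : Primrec f) : Primrec fun a => pinit (f a) :=
  p_un1 (p_un2 (p_un1 hf))

theorem p_ptr {f : α → ℕ} (hf : Primrec f) : Primrec fun a => ptr (f a) :=
  Primrec.option_getD.comp (Primrec.decode.comp (p_un1 (p_un2 (p_un2 (p_un1 hf)))))
    (Primrec.const [])

theorem p_plb {f : α → ℕ} (hf : Primrec f) : Primrec fun a => plb (f a) :=
  Primrec.option_getD.comp (Primrec.decode.comp (p_un2 (p_un2 (p_un2 (p_un1 hf)))))
    (Primrec.const [])

theorem p_pC {f : α → ℕ} (hf : Primrec f) : Primrec fun a => pC (f a) := p_un2 hf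

theorem p_lev {f g : α → ℕ} (hf : Primrec f) (hg : Primrec g) : Primrec fun a => lev (f a) (g a) :=
  p_pow (p_fact (p_Bd (p_pm hf) (p_pC hf))) (p_sub (p_add (p_pC hf) (Primrec.const 1)) hg)

theorem p_pL {f : α → ℕ} (hf : Primrec f) : Primrec fun a => pL (f a) :=
  p_lev hf (Primrec.const 0)

theorem p_pBx {f : α → ℕ} (hf : Primrec f) : Primrec fun a => pBx (f a) :=
  p_pair (p_add (p_mul (Primrec.const 2) (p_pC hf)) (Primrec.const 2))
    (p_mul (Primrec.const 2) (p_pL hf))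

theorem p_pBnd {f : α → ℕ} (hf : Primrec f) : Primrec fun a => pBnd (f a) :=
  p_pow (p_pm hf) (p_pBx hf)

theorem p_fold {f g : α → ℕ} (hf : Primrec f) (hg : Primrec g) : Primrec fun a => fold (f a) (g a) :=
  Primrec.ite (p_lt hg hf) hg (p_add hf (p_mod hg hf))

theorem p_dig {f g h : α → ℕ} (hf : Primrec f) (hg : Primrec g) (hh : Primrec h) :
    Primrec fun a => dig (f a) (g a) (h a) :=
  p_mod (p_div hg (p_pow hf hh)) hf

theorem p_ltr {n e v i : α → ℕ} (hn : Primrec n) (he : Primrec e) (hv : Primrec v)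
    (hi : Primrec i) : Primrec fun a => ltr (n a) (e a) (v a) (i a) :=
  p_dig (p_pm hn) he (p_pair hv (p_fold (p_pL hn) hi))

theorem p_inRow {l : α → List (List ℕ)} {c b : α → ℕ} (hl : Primrec l) (hc : Primrec c)
    (hb : Primrec b) : PrimrecPred fun a => inRow (l a) (c a) (b a) := by
  refine (p_lt (Primrec.const 0) hc).and ?_
  have h : PrimrecRel (fun (x y : ℕ) => x = y) := Primrec.eq
  exact (PrimrecRel.exists_mem_list h).comp
    ((Primrec.list_getD ([] : List ℕ)).comp hl (p_sub hc (Primrec.const 1))) hb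

theorem p_hasLab {n c d : α → ℕ} (hn : Primrec n) (hc : Primrec c) (hd : Primrec d) :
    PrimrecPred fun a => hasLab (n a) (c a) (d a) :=
  p_inRow (p_plb hn) hd hc

theorem p_hasTr {n c d : α → ℕ} (hn : Primrec n) (hc : Primrec c) (hd : Primrec d) :
    PrimrecPred fun a => hasTr (n a) (c a) (d a) :=
  (p_lt (Primrec.const 0) hd).and (p_inRow (p_ptr hn) hc (p_sub hd (Primrec.const 1)))

theorem p_TQ {T c e i : α → ℕ} (hT : Primrec T) (hc : Primrec c) (he : Primrec e)
    (hi : Primrec i) : PrimrecPred fun a => TQ (T a) (c a) (e a) (i a) :=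
  p_eq (p_dig (Primrec.const 2) hT (p_pair (Primrec.const 1) (p_pair hc (p_pair he hi))))
    (Primrec.const 1)

theorem p_TH {T c e : α → ℕ} (hT : Primrec T) (hc : Primrec c) (he : Primrec e) :
    PrimrecPred fun a => TH (T a) (c a) (e a) :=
  p_eq (p_dig (Primrec.const 2) hT (p_pair (Primrec.const 0) (p_pair hc he)))
    (Primrec.const 1)

theorem p_up {f : α → ℕ} (hf : Primrec f) : Primrec fun x : α × ℕ => f x.1 :=
  hf.comp Primrec.fst

theorem p_agree {n v e e' : α → ℕ} (hn : Primrec n) (hv : Primrec v) (he : Primrec e)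
    (he' : Primrec e') : PrimrecPred fun a => agree (n a) (v a) (e a) (e' a) :=
  p_forall (p_pBx hn) ((p_eq (p_un1 Primrec.snd) (p_up hv)).or
    (p_eq (p_dig (p_pm (p_up hn)) (p_up he') Primrec.snd)
      (p_dig (p_pm (p_up hn)) (p_up he) Primrec.snd)))

theorem p_isUp {n v c e : α → ℕ} (hn : Primrec n) (hv : Primrec v) (hc : Primrec c)
    (he : Primrec e) : PrimrecPred fun a => isUp (n a) (v a) (c a) (e a) :=
  p_forall (p_mul (Primrec.const 2) (p_pL hn))
    ((p_lt Primrec.snd (p_lev (p_up hn) (p_up hc))).or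
    (p_eq (p_ltr (p_up hn) (p_up he) (p_up hv) (p_add Primrec.snd (p_lev (p_up hn) (p_up hc))))
      (p_ltr (p_up hn) (p_up he) (p_up hv) Primrec.snd)))

theorem p_isCon {n v e : α → ℕ} (hn : Primrec n) (hv : Primrec v)
    (he : Primrec e) : PrimrecPred fun a => isCon (n a) (v a) (e a) :=
  (p_eq (p_ltr hn he hv (Primrec.const 0)) (p_add (p_pinit hn) (Primrec.const 1))).and
  (p_forall (p_mul (Primrec.const 2) (p_pL hn))
    (p_hasTr (p_up hn) (p_ltr (p_up hn) (p_up he) (p_up hv) Primrec.snd)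
      (p_ltr (p_up hn) (p_up he) (p_up hv) (p_add Primrec.snd (Primrec.const 1)))))

theorem p_ruleQ {n T c e i : α → ℕ} (hn : Primrec n) (hT : Primrec T) (hc : Primrec c)
    (he : Primrec e) (hi : Primrec i) :
    PrimrecPred fun a => ruleQ (n a) (TQ (T a)) (c a) (e a) (i a) := by
  have t := p_un1 hc
  have r := p_un2 hc
  have r1 := p_un1 r
  have r2 := p_un2 r
  have two : ∀ {g : α → ℕ}, Primrec g → Primrec fun a => 2 * g a :=
    fun hg => p_mul (Primrec.const 2) hg
  refine ((p_eq t (Primrec.const 0)).and (p_hasLab hn r1 (p_ltr hn he (two r2) hi))).or ?_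
  refine ((p_eq t (Primrec.const 1)).and
    (p_eq (p_ltr hn he (p_add (two r) (Primrec.const 1)) hi) (Primrec.const 0)).not).or ?_
  refine ((p_eq t (Primrec.const 2)).and ((p_lt r hc).and (p_TQ hT r he hi)).not).or ?_
  refine ((p_eq t (Primrec.const 3)).and (((p_lt r1 hc).and (p_TQ hT r1 he hi)).and
    ((p_lt r2 hc).and (p_TQ hT r2 he hi)))).or ?_
  refine ((p_eq t (Primrec.const 4)).and ((p_lt r hc).and (p_TQ hT r he
    (p_fold (p_pL hn) (p_add hi (Primrec.const 1)))))).or ?_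
  refine (p_eq t (Primrec.const 5)).and (p_exists
    (p_add (p_add hi (two (p_pL hn))) (Primrec.const 1)) ?_)
  refine (p_lt Primrec.snd (p_up hi)).not.and (((p_lt (p_up r2) (p_up hc)).and
    (p_TQ (p_up hT) (p_up r2) (p_up he) (p_fold (p_pL (p_up hn)) Primrec.snd))).and ?_)
  refine p_forall Primrec.snd ((p_lt Primrec.snd (p_up (p_up hi))).or
    ((p_lt (p_up (p_up r1)) (p_up (p_up hc))).and
    (p_TQ (p_up (p_up hT)) (p_up (p_up r1)) (p_up (p_up he))
      (p_fold (p_pL (p_up (p_up hn))) Primrec.snd))))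

theorem p_ruleH {n T c e : α → ℕ} (hn : Primrec n) (hT : Primrec T) (hc : Primrec c)
    (he : Primrec e) :
    PrimrecPred fun a => ruleH (n a) (TQ (T a)) (TH (T a)) (c a) (e a) := by
  have t := p_un1 hc
  have r := p_un2 hc
  have r1 := p_un1 r
  have r2 := p_un2 r
  have v0 := p_mul (Primrec.const (α := α) 2) r1
  have v1 := p_add v0 (Primrec.const 1)
  have s : Primrec (Prod.snd : α × ℕ → ℕ) := Primrec.snd
  have tt := (p_lt (p_up r2) (p_up hc)).and (p_TH (p_up hT) (p_up r2) s)
  have c0 := (p_agree (p_up hn) (p_up v0) (p_up he) s).and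
    ((p_isUp (p_up hn) (p_up v0) (p_up r2) s).and (p_isCon (p_up hn) (p_up v0) s))
  have c1 := (p_agree (p_up hn) (p_up v1) (p_up he) s).and
    (p_isUp (p_up hn) (p_up v1) (p_up r2) s)
  refine ((p_eq t (Primrec.const 0)).and (p_TQ hT r he (Primrec.const 0))).or ?_
  refine ((p_eq t (Primrec.const 1)).and (p_exists (p_pBnd hn) (c0.and tt))).or ?_
  refine ((p_eq t (Primrec.const 2)).and (p_forall (p_pBnd hn) (c0.not.or tt))).or ?_
  refine ((p_eq t (Primrec.const 3)).and (p_exists (p_pBnd hn) (c1.and tt))).or ?_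
  exact ((p_eq t (Primrec.const 4)).and (p_forall (p_pBnd hn) (c1.not.or tt)))

theorem p_consistent : PrimrecPred fun a : ℕ × ℕ => consistent a.1 a.2 := by
  have n : Primrec (fun a : ℕ × ℕ => a.1) := Primrec.fst
  have T : Primrec (fun a : ℕ × ℕ => a.2) := Primrec.snd
  have bc := p_add (p_pC n) (Primrec.const 1)
  have n1 := p_up n
  have n2 := p_up n1
  have n3 := p_up n2
  have T2 := p_up (p_up T)
  have T3 := p_up T2
  refine PrimrecPred.and ?_ ?_
  · refine p_forall bc (p_forall (p_pBnd n1) (p_forall (p_mul (Primrec.const 2) (p_pL n2)) ?_))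
    exact p_iff (p_TQ T3 (Primrec.snd.comp (Primrec.fst.comp Primrec.fst))
      (Primrec.snd.comp Primrec.fst) Primrec.snd)
      (p_ruleQ n3 T3 (Primrec.snd.comp (Primrec.fst.comp Primrec.fst))
      (Primrec.snd.comp Primrec.fst) Primrec.snd)
  · refine p_forall bc (p_forall (p_pBnd n1) ?_)
    exact p_iff (p_TH T2 (Primrec.snd.comp Primrec.fst) Primrec.snd)
      (p_ruleH n2 T2 (Primrec.snd.comp Primrec.fst) Primrec.snd)

/-- Search for a table. -/
theorem computable_search {R O : ℕ → ℕ → Prop} (hR : PrimrecPred fun a : ℕ × ℕ => R a.1 a.2)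
    (hO : PrimrecPred fun a : ℕ × ℕ => O a.1 a.2) (hex : ∀ n, ∃ T, R n T) :
    ∃ f : ℕ → Bool, Computable f ∧ ∀ n, ∃ T, R n T ∧ (f n = true ↔ O n T) := by
  classical
  refine ⟨fun n => decide (O n (Nat.find (hex n))), ?_, fun n => ⟨_, Nat.find_spec (hex n), by simp⟩⟩
  have h1 : Primrec fun a : ℕ × ℕ => decide (R a.1 a.2) := hR.decide
  have h2 : Primrec fun a : ℕ × ℕ => decide (O a.1 a.2) := hO.decide
  have h3 : Partrec fun n : ℕ => Nat.rfind (fun T => Part.some (decide (R n T))) :=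
    Partrec.rfind (p := fun n T => Part.some (decide (R n T))) (h1.to_comp).partrec
  have h4 : Computable fun n : ℕ => Nat.find (hex n) := by
    refine Partrec.of_eq h3 fun n => ?_
    refine Part.eq_some_iff.2 ?_
    refine Nat.mem_rfind.2 ⟨?_, ?_⟩
    · simpa using Nat.find_spec (hex n)
    · intro m hm
      simpa using Nat.find_min (hex n) hm
  exact h2.to_comp.comp (Computable.pair Computable.id h4)

end prim

end HQ
namespace HQ

/-! ### Correctness of the algorithm -/

theorem exists_dig {m : ℕ} (B : ℕ) : ∀ g : ℕ → ℕ, (∀ k, g k < m) →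
    ∃ e < m ^ B, ∀ k < B, dig m e k = g k := by
  induction B with
  | zero => intro g hg; exact ⟨0, by simp, by simp⟩
  | succ B ih =>
    intro g hg
    obtain ⟨e, he, h⟩ := ih (fun k => g (k+1)) (fun k => hg _)
    have h0 := hg 0
    have hm : 0 < m := by omega
    refine ⟨g 0 + m * e, ?_, ?_⟩
    · have : m * (e + 1) ≤ m * m ^ B := Nat.mul_le_mul_left m he
      rw [Nat.pow_succ, Nat.mul_comm (m ^ B)]
      rw [Nat.mul_add] at this
      omega
    · intro k hk
      cases k with
      | zero => simp [dig, Nat.mod_eq_of_lt h0]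
      | succ k =>
        rw [← h k (by omega)]
        unfold dig
        rw [Nat.pow_succ, Nat.mul_comm (m ^ k), ← Nat.div_div_eq_div_mul,
          Nat.add_mul_div_left _ _ hm, Nat.div_eq_of_lt h0, Nat.zero_add]

theorem dig_zero {m e B k : ℕ} (hm : 0 < m) (he : e < m ^ B) (hk : B ≤ k) : dig m e k = 0 := by
  unfold dig
  rw [Nat.div_eq_of_lt (lt_of_lt_of_le he (Nat.pow_le_pow_right hm hk)), Nat.zero_mod]

theorem pair_lt {a a' b b' : ℕ} (h : a ≤ a') (h' : b < b') : Nat.pair a b < Nat.pair a' b' := by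
  rcases Nat.lt_or_ge a a' with h1 | h1
  · exact (Nat.pair_lt_pair_left b h1).trans (Nat.pair_lt_pair_right a' h')
  · have : a = a' := le_antisymm h h1
    subst this
    exact Nat.pair_lt_pair_right a h'

theorem pU_pos (n : ℕ) : 0 < pU n := Nat.factorial_pos _
theorem lev_pos (n c : ℕ) : 0 < lev n c := Nat.pow_pos (pU_pos n)
theorem pL_pos (n : ℕ) : 0 < pL n := lev_pos n 0
theorem lev_dvd {n c c' : ℕ} (h : c ≤ c') : lev n c' ∣ lev n c :=
  Nat.pow_dvd_pow _ (by omega)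
theorem lev_le (n c : ℕ) : lev n c ≤ pL n := Nat.le_of_dvd (pL_pos n) (lev_dvd (Nat.zero_le c))
theorem lev_mul {n c c' : ℕ} (h : c' < c) (hc : c ≤ pC n) : lev n c * pU n ∣ lev n c' := by
  unfold lev
  rw [← Nat.pow_succ]
  exact Nat.pow_dvd_pow _ (by omega)

theorem fold_lt {L : ℕ} (h : 0 < L) (i : ℕ) : fold L i < 2 * L := by
  unfold fold
  have := Nat.mod_lt i h
  split <;> omega

theorem fold_self {L i : ℕ} (h : i < 2 * L) : fold L i = i := by
  unfold fold
  split
  · rfl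
  · have : i % L = i - L := by
      rw [Nat.mod_eq_sub_mod (by omega), Nat.mod_eq_of_lt (by omega)]
    omega

theorem fold_add {L : ℕ} (l a : ℕ) : fold L (fold L l + a) = fold L (l + a) := by
  unfold fold
  by_cases h : l < L
  · simp [h]
  · have h1 : ¬ (L + l % L + a < L) := by omega
    have h2 : ¬ (l + a < L) := by omega
    simp only [h, h1, h2, if_false]
    congr 1
    rw [Nat.add_assoc, Nat.add_mod_left, Nat.mod_add_mod]

theorem le_fold {L M l : ℕ} (h : M ≤ l) (h' : M ≤ L) : M ≤ fold L l := by
  unfold fold; split <;> omega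

theorem ruleQ_congr {n : ℕ} {t t' : ℕ → ℕ → ℕ → Prop} {c e i : ℕ} (hi : i < 2 * pL n)
    (h : ∀ c' < c, ∀ j < 2 * pL n, (t c' e j ↔ t' c' e j)) :
    ruleQ n t c e i ↔ ruleQ n t' c e i := by
  have g : ∀ c' j, j < 2 * pL n → ((c' < c ∧ t c' e j) ↔ (c' < c ∧ t' c' e j)) :=
    fun c' j hj => and_congr_right fun hc => h c' hc j hj
  unfold ruleQ
  simp only [g _ _ hi, g _ _ (fold_lt (pL_pos n) _)]

theorem ruleH_congr {n : ℕ} {t1 t1' : ℕ → ℕ → ℕ → Prop} {t t' : ℕ → ℕ → Prop} {c e : ℕ}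
    (h1 : t1 c.unpair.2 e 0 ↔ t1' c.unpair.2 e 0)
    (h : ∀ c' < c, ∀ e' < pBnd n, (t c' e' ↔ t' c' e')) :
    ruleH n t1 t c e ↔ ruleH n t1' t' c e := by
  have g : ∀ c' e', e' < pBnd n → ((c' < c ∧ t c' e') ↔ (c' < c ∧ t' c' e')) :=
    fun c' j hj => and_congr_right fun hc => h c' hc j hj
  unfold ruleH
  refine or_congr (and_congr Iff.rfl h1) (or_congr (and_congr Iff.rfl ?_) (or_congr
    (and_congr Iff.rfl ?_) (or_congr (and_congr Iff.rfl ?_) (and_congr Iff.rfl ?_))))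
  · exact exists_congr fun e' => and_congr_right fun he' => and_congr Iff.rfl (g _ _ he')
  · exact forall_congr' fun e' => forall_congr' fun he' => or_congr Iff.rfl (g _ _ he')
  · exact exists_congr fun e' => and_congr_right fun he' => and_congr Iff.rfl (g _ _ he')
  · exact forall_congr' fun e' => forall_congr' fun he' => or_congr Iff.rfl (g _ _ he')

def itQ (n : ℕ) : ℕ → ℕ → ℕ → ℕ → Prop
  | 0 => fun _ _ _ => False
  | k+1 => ruleQ n (itQ n k)

theorem itQ_stable (n c : ℕ) : ∀ e i, i < 2 * pL n → ∀ k, c < k →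
    (itQ n k c e i ↔ itQ n (c+1) c e i) := by
  induction c using Nat.strong_induction_on with
  | _ c ih =>
    intro e i hi k hk
    cases k with
    | zero => omega
    | succ k =>
      refine ruleQ_congr hi fun c' hc' j hj => ?_
      rw [ih c' hc' e j hj k (by omega), ih c' hc' e j hj c hc']

def itH (n : ℕ) (t1 : ℕ → ℕ → ℕ → Prop) : ℕ → ℕ → ℕ → Prop
  | 0 => fun _ _ => False
  | k+1 => ruleH n t1 (itH n t1 k)

theorem itH_stable (n : ℕ) (t1 : ℕ → ℕ → ℕ → Prop) (c : ℕ) : ∀ e, e < pBnd n → ∀ k, c < k →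
    (itH n t1 k c e ↔ itH n t1 (c+1) c e) := by
  induction c using Nat.strong_induction_on with
  | _ c ih =>
    intro e he k hk
    cases k with
    | zero => omega
    | succ k =>
      refine ruleH_congr Iff.rfl fun c' hc' j hj => ?_
      rw [ih c' hc' j hj k (by omega), ih c' hc' j hj c hc']

theorem exists_consistent (n : ℕ) : ∃ T, consistent n T := by
  classical
  set t1 : ℕ → ℕ → ℕ → Prop := fun c e i => itQ n (c+1) c e i with ht1
  set t0 : ℕ → ℕ → Prop := fun c e => itH n t1 (c+1) c e with ht0
  have f1 : ∀ c e i, i < 2 * pL n → (t1 c e i ↔ ruleQ n t1 c e i) := by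
    intro c e i hi
    refine ruleQ_congr hi fun c' hc' j hj => ?_
    exact itQ_stable n c' e j hj c hc'
  have f0 : ∀ c e, (t0 c e ↔ ruleH n t1 t0 c e) := by
    intro c e
    refine ruleH_congr Iff.rfl fun c' hc' j hj => ?_
    exact itH_stable n t1 c' j hj c hc'
  obtain ⟨T, -, hT⟩ := exists_dig (m := 2)
    (Nat.pair 1 (Nat.pair (pC n + 1) (Nat.pair (pBnd n) (2 * pL n))))
    (fun k => if (k.unpair.1 = 1 ∧
        t1 k.unpair.2.unpair.1 k.unpair.2.unpair.2.unpair.1 k.unpair.2.unpair.2.unpair.2) ∨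
      (k.unpair.1 = 0 ∧ t0 k.unpair.2.unpair.1 k.unpair.2.unpair.2) then 1 else 0)
    (fun k => by split <;> omega)
  have e1 : ∀ c e i, c < pC n + 1 → e < pBnd n → i < 2 * pL n → (TQ T c e i ↔ t1 c e i) := by
    intro c e i hc he hi
    unfold TQ
    rw [hT _ (pair_lt le_rfl (pair_lt hc.le (pair_lt he.le hi)))]
    simp
  have e0 : ∀ c e, c < pC n + 1 → e < pBnd n → (TH T c e ↔ t0 c e) := by
    intro c e hc he
    unfold TH
    rw [hT _ (pair_lt (by omega) (pair_lt hc.le (lt_of_lt_of_le he (Nat.left_le_pair _ _))))]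
    simp
  refine ⟨T, ?_, ?_⟩
  · intro c hc e he i hi
    rw [e1 c e i hc he hi, f1 c e i hi]
    exact ruleQ_congr hi fun c' hc' j hj => (e1 c' e j (by omega) he hj).symm
  · intro c hc e he
    rw [e0 c e hc he, f0 c e]
    refine ruleH_congr ?_ fun c' hc' j hj => (e0 c' j (by omega) hj).symm
    have := Nat.unpair_right_le c
    have := pL_pos n
    exact (e1 _ e 0 (by omega) he (by omega)).symm

/-! ### Decoding environments -/

theorem pm_pos (n : ℕ) : 0 < pm n := Nat.succ_pos _

def dec (n e : ℕ) : Env (Fin (pm n)) := fun v i => ⟨ltr n e v i, Nat.mod_lt _ (pm_pos n)⟩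

theorem dec_fold (n e v i a : ℕ) : dec n e v (fold (pL n) i + a) = dec n e v (i + a) := by
  apply Fin.ext
  simp only [dec, ltr, fold_add]

theorem pm_eq (K : FinKripke) (c : ℕ) : pm (Nat.pair K.enc c) = K.n + 2 := by
  simp [pm, FinKripke.enc]

theorem pinit_eq (K : FinKripke) (c : ℕ) : pinit (Nat.pair K.enc c) = K.init.val := by
  simp [pinit, FinKripke.enc]

theorem inRow_finRange {N : ℕ} (r : Fin N → List ℕ) (c a : ℕ) :
    inRow ((List.finRange N).map r) c a ↔ ∃ s : Fin N, c = s.val + 1 ∧ a ∈ r s := by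
  unfold inRow
  constructor
  · rintro ⟨h0, b, hb, rfl⟩
    by_cases h : c - 1 < N
    · refine ⟨⟨c-1, h⟩, by simp; omega, ?_⟩
      simpa [List.getD_eq_getElem?_getD, h] using hb
    · simp [List.getD_eq_getElem?_getD, h] at hb
  · rintro ⟨s, rfl, ha⟩
    refine ⟨by omega, a, ?_, rfl⟩
    simpa [List.getD_eq_getElem?_getD] using ha

theorem hasLab_iff (K : FinKripke) (x a c : ℕ) :
    hasLab (Nat.pair K.enc x) a c ↔ a ∈ labL K c := by
  have : plb (Nat.pair K.enc x) = (List.finRange K.n).map fun s => (K.label s).sort (· ≤ ·) := by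
    simp [plb, FinKripke.enc]
  unfold hasLab
  rw [this, inRow_finRange]
  simp [labL]

theorem hasTr_iff (K : FinKripke) (x c d : ℕ) :
    hasTr (Nat.pair K.enc x) c d ↔ stepR K c d := by
  have : ptr (Nat.pair K.enc x) =
      (List.finRange K.n).map fun s => ((K.trans s).sort (· ≤ ·)).map Fin.val := by
    simp [ptr, FinKripke.enc]
  unfold hasTr
  rw [this, inRow_finRange]
  unfold stepR
  constructor
  · rintro ⟨h0, s, hc, hd⟩
    simp only [List.mem_map, Finset.mem_sort] at hd
    obtain ⟨t, ht, htd⟩ := hd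
    exact ⟨s, t, hc, by omega, ht⟩
  · rintro ⟨s, t, hc, rfl, ht⟩
    refine ⟨by omega, s, hc, ?_⟩
    simp only [List.mem_map, Finset.mem_sort]
    exact ⟨t, ht, by omega⟩

end HQ
namespace HQ

theorem QF_shift' {m : ℕ} (K : FinKripke) (w : Env (Fin m)) (ψ : QF) : ∀ i i',
    (∀ v a, w v (i + a) = w v (i' + a)) →
    (QF.Sat (PiOf K w) (sgOf w) i ψ ↔ QF.Sat (PiOf K w) (sgOf w) i' ψ) := by
  induction ψ with
  | atom a π =>
    intro i i' h
    have := h (2*π) 0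
    simp only [Nat.add_zero] at this
    simp only [QF.Sat, PiOf, this]
  | patom q =>
    intro i i' h
    have := h (2*q+1) 0
    simp only [Nat.add_zero] at this
    simp only [QF.Sat, sgOf, Set.mem_setOf_eq, this]
  | not ψ ih => intro i i' h; simp only [QF.Sat, ih i i' h]
  | and ψ1 ψ2 ih1 ih2 => intro i i' h; simp only [QF.Sat, ih1 i i' h, ih2 i i' h]
  | next ψ ih =>
    intro i i' h
    simp only [QF.Sat]
    refine ih _ _ fun v a => ?_
    have := h v (1 + a)
    rwa [← Nat.add_assoc, ← Nat.add_assoc] at this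
  | xuntil ψ1 ψ2 ih1 ih2 =>
    have main : ∀ i i', (∀ v a, w v (i + a) = w v (i' + a)) →
        QF.Sat (PiOf K w) (sgOf w) i (.xuntil ψ1 ψ2) →
        QF.Sat (PiOf K w) (sgOf w) i' (.xuntil ψ1 ψ2) := by
      intro i i' h
      have hh : ∀ b v a, w v (i + b + a) = w v (i' + b + a) := by
        intro b v a
        rw [Nat.add_assoc, Nat.add_assoc]; exact h v (b + a)
      rintro ⟨k, hk, h2, h1⟩
      obtain ⟨b, rfl⟩ := Nat.exists_eq_add_of_le hk
      refine ⟨i' + b, by omega, (ih2 _ _ (hh b)).1 h2, fun j hj hj' => ?_⟩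
      obtain ⟨d, rfl⟩ := Nat.exists_eq_add_of_le hj
      exact (ih1 _ _ (hh d)).1 (h1 (i + d) (by omega) (by omega))
    intro i i' h
    exact ⟨main i i' h, main i' i fun v a => (h v a).symm⟩

theorem fold_period {L t : ℕ} (h : L ≤ t) : fold L (t + L) = fold L t := by
  unfold fold
  have h1 : ¬ (t + L < L) := by omega
  have h2 : ¬ (t < L) := by omega
  simp [h1, h2]

theorem Up_dec (n e : ℕ) : Up (pL n) (dec n e) := by
  intro v t ht
  apply Fin.ext
  simp only [dec, ltr, fold_period ht]

theorem self_fold {A : Type} {L : ℕ} {x : ℕ → A} (hx : ∀ t, L ≤ t → x (t + L) = x t) (i : ℕ) :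
    x (fold L i) = x i := by
  unfold fold
  split
  · rfl
  · rename_i h
    have hm : ∀ k t, L ≤ t → x (t + L * k) = x t := fun k t ht =>
      Up.mul (w := fun _ => x) (M := L) (fun _ t ht => hx t ht) 0 t k ht
    by_cases h0 : L = 0
    · subst h0; simp
    have h1 : 1 ≤ i / L := (Nat.le_div_iff_mul_le (by omega)).2 (by omega)
    rw [← hm (i / L - 1) (L + i % L) (by omega)]
    congr 1
    have h2 := Nat.div_add_mod i L
    obtain ⟨d, hd⟩ := Nat.exists_eq_add_of_le h1
    rw [hd] at h2 ⊢
    rw [Nat.mul_add, Nat.mul_one] at h2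
    simp only [Nat.add_sub_cancel_left]
    omega

theorem lt_pair {t x : ℕ} (h : 1 ≤ t) : x < Nat.pair t x := by
  have := Nat.add_le_pair t x
  omega

theorem QF_correct (K : FinKripke) (x n : ℕ) (hn : n = Nat.pair K.enc x) {T : ℕ}
    (hT : consistent n T) (ψ : QF) (hψ : ψ.enc ≤ pC n) {e : ℕ} (he : e < pBnd n) :
    ∀ i, i < 2 * pL n →
    (TQ T ψ.enc e i ↔ QF.Sat (PiOf K (dec n e)) (sgOf (dec n e)) i ψ) := by
  have hL := pL_pos n
  have sf : ∀ (ψ : QF) i, QF.Sat (PiOf K (dec n e)) (sgOf (dec n e)) (fold (pL n) i) ψ ↔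
      QF.Sat (PiOf K (dec n e)) (sgOf (dec n e)) i ψ := fun ψ i =>
    QF_shift' K _ ψ _ _ fun v a => dec_fold n e v i a
  induction ψ with
  | atom a π =>
    intro i hi
    rw [hT.1 _ (by omega) e he i hi]
    simp only [ruleQ, QF.enc, Nat.unpair_pair, QF.Sat, PiOf]
    subst hn
    simp [hasLab_iff, dec]
  | patom q =>
    intro i hi
    rw [hT.1 _ (by omega) e he i hi]
    simp only [ruleQ, QF.enc, Nat.unpair_pair, QF.Sat, sgOf]
    simp [dec]
  | not ψ ih =>
    intro i hi
    rw [hT.1 _ (by omega) e he i hi]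
    have hlt : ψ.enc < Nat.pair 2 ψ.enc := lt_pair (by omega)
    have := ih (by simp only [QF.enc] at hψ; omega) i hi
    simp only [ruleQ, QF.enc, Nat.unpair_pair, QF.Sat]
    simp [this, hlt]
  | and ψ1 ψ2 ih1 ih2 =>
    intro i hi
    rw [hT.1 _ (by omega) e he i hi]
    have hlt : Nat.pair ψ1.enc ψ2.enc < Nat.pair 3 (Nat.pair ψ1.enc ψ2.enc) := lt_pair (by omega)
    have l1 := Nat.left_le_pair ψ1.enc ψ2.enc
    have l2 := Nat.right_le_pair ψ1.enc ψ2.enc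
    simp only [QF.enc] at hψ
    have i1 := ih1 (by omega) i hi
    have i2 := ih2 (by omega) i hi
    have g1 := lt_of_le_of_lt l1 hlt
    have g2 := lt_of_le_of_lt l2 hlt
    simp only [ruleQ, QF.enc, Nat.unpair_pair, QF.Sat]
    simp [i1, i2, g1, g2]
  | next ψ ih =>
    intro i hi
    rw [hT.1 _ (by omega) e he i hi]
    have hlt : ψ.enc < Nat.pair 4 ψ.enc := lt_pair (by omega)
    have := ih (by simp only [QF.enc] at hψ; omega) _ (fold_lt hL (i+1))
    simp only [ruleQ, QF.enc, Nat.unpair_pair, QF.Sat]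
    simp [this, hlt, sf]
  | xuntil ψ1 ψ2 ih1 ih2 =>
    intro i hi
    rw [hT.1 _ (by omega) e he i hi]
    have hlt : Nat.pair ψ1.enc ψ2.enc < Nat.pair 5 (Nat.pair ψ1.enc ψ2.enc) := lt_pair (by omega)
    have l1 := Nat.left_le_pair ψ1.enc ψ2.enc
    have l2 := Nat.right_le_pair ψ1.enc ψ2.enc
    simp only [QF.enc] at hψ
    have i1 : ∀ j, _ := fun j => ih1 (by omega) _ (fold_lt hL j)
    have i2 : ∀ j, _ := fun j => ih2 (by omega) _ (fold_lt hL j)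
    have g1 := lt_of_le_of_lt l1 hlt
    have g2 := lt_of_le_of_lt l2 hlt
    simp only [ruleQ, QF.enc, Nat.unpair_pair, QF.Sat]
    simp only [i1, i2, g1, g2, sf, true_and]
    simp only [OfNat.ofNat_ne_zero, OfNat.ofNat_ne_one, false_and, false_or, true_and,
      Nat.reduceEqDiff]
    constructor
    · rintro ⟨k, -, hk, h2, h1⟩
      refine ⟨k, by omega, h2, fun j hj hj' => ?_⟩
      rcases h1 j hj' with h | h
      · omega
      · exact h
    · intro hex
      classical
      obtain ⟨hk, h2, h1⟩ := Nat.find_spec hex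
      have hmin := fun k => Nat.find_min hex (m := k)
      generalize Nat.find hex = k at hk h2 h1 hmin
      refine ⟨k, ?_, by omega, h2, fun j hj => ?_⟩
      · by_contra hcon
        refine hmin (k - pL n) (by omega) ⟨by omega, ?_, fun j hj hj' => h1 j hj (by omega)⟩
        refine (QF_shift' K _ ψ2 k (k - pL n) fun v a => ?_).1 h2
        rw [← Up_dec n e v (k - pL n + a) (by omega)]
        congr 1; omega
      · by_cases hji : j < i
        · exact Or.inl hji
        · exact Or.inr (h1 j (by omega) hj)

theorem pair_lt_Bx {n v i : ℕ} (hv : v < 2 * pC n + 2) : Nat.pair v (fold (pL n) i) < pBx n :=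
  pair_lt hv.le (fold_lt (pL_pos n) i)

theorem exists_upd {n e v : ℕ} (hv : v < 2 * pC n + 2) (he : e < pBnd n)
    (x : ℕ → Fin (pm n)) (hx : ∀ t, pL n ≤ t → x (t + pL n) = x t) :
    ∃ e' < pBnd n, agree n v e e' ∧ dec n e' = Function.update (dec n e) v x := by
  obtain ⟨e', he', h⟩ := exists_dig (m := pm n) (pBx n)
    (fun k => if k.unpair.1 = v then (x k.unpair.2).val else dig (pm n) e k)
    (fun k => by
      split
      · exact Fin.isLt _
      · exact Nat.mod_lt _ (pm_pos n))
  refine ⟨e', he', ?_, ?_⟩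
  · intro k hk
    by_cases hkv : k.unpair.1 = v
    · exact Or.inl hkv
    · right; rw [h k hk, if_neg hkv]
  · funext v' i
    apply Fin.ext
    by_cases hvv : v' = v
    · subst hvv
      simp only [dec, ltr, Function.update_self]
      rw [h _ (pair_lt_Bx hv)]
      simp [self_fold hx]
    · simp only [Function.update_of_ne hvv]
      simp only [dec, ltr]
      by_cases hk : Nat.pair v' (fold (pL n) i) < pBx n
      · rw [h _ hk]; simp [hvv]
      · rw [dig_zero (pm_pos n) he' (by omega), dig_zero (pm_pos n) he (by omega)]

theorem agree_upd {n e v e' : ℕ} (he : e < pBnd n) (he' : e' < pBnd n) (h : agree n v e e') :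
    dec n e' = Function.update (dec n e) v (dec n e' v) := by
  funext v' i
  by_cases hvv : v' = v
  · subst hvv; simp
  · simp only [Function.update_of_ne hvv]
    apply Fin.ext
    simp only [dec, ltr]
    by_cases hk : Nat.pair v' (fold (pL n) i) < pBx n
    · rcases h _ hk with h1 | h1
      · simp [hvv] at h1
      · exact h1
    · rw [dig_zero (pm_pos n) he' (by omega), dig_zero (pm_pos n) he (by omega)]

theorem isUp_iff (n v c e : ℕ) :
    isUp n v c e ↔ ∀ t, lev n c ≤ t → dec n e v (t + lev n c) = dec n e v t := by
  constructor
  · intro h t ht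
    rcases h (fold (pL n) t) (fold_lt (pL_pos n) t) with h1 | h1
    · have := le_fold ht (lev_le n c)
      omega
    · have h2 : dec n e v (fold (pL n) t + lev n c) = dec n e v (fold (pL n) t + 0) := Fin.ext h1
      rwa [dec_fold, dec_fold] at h2
  · intro h l _
    by_cases hl : l < lev n c
    · exact Or.inl hl
    · right
      exact congrArg Fin.val (h l (by omega))

theorem isCon_iff (K : FinKripke) (x n : ℕ) (hn : n = Nat.pair K.enc x) (v e : ℕ) :
    isCon n v e ↔ Con K (dec n e v) 0 := by
  have hi : pinit n = K.init.val := by rw [hn, pinit_eq]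
  have ht : ∀ c d, hasTr n c d ↔ stepR K c d := by intro c d; rw [hn, hasTr_iff]
  unfold isCon Con
  rw [hi]
  simp only [ht]
  refine and_congr Iff.rfl ⟨fun h l _ => ?_, fun h l _ => h l (Nat.zero_le l)⟩
  have := h (fold (pL n) l) (fold_lt (pL_pos n) l)
  have h1 := dec_fold n e v l 0
  have h2 := dec_fold n e v l 1
  rw [← h2]
  have h3 : dec n e v l = dec n e v (fold (pL n) l) := h1.symm
  rw [h3]
  exact this

theorem exists_step {n c c' v e : ℕ} {P : Env (Fin (pm n)) → ℕ → Prop} (hP : Recog P (pN n))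
    (hc : c' < c) (hcC : c ≤ pC n) (hv : v < 2 * pC n + 2) (he : e < pBnd n)
    (hu : Up (lev n c) (dec n e)) :
    (∃ x, P (Function.update (dec n e) v x) 0) ↔
    ∃ e' < pBnd n, (agree n v e e' ∧ isUp n v c' e') ∧ P (dec n e') 0 := by
  constructor
  · rintro ⟨x, hx⟩
    obtain ⟨x', h1, h2⟩ := hP.pump (lev_pos n c) hu v x hx
    have h3 : Up (lev n c') (Function.update (dec n e) v x') := h2.dvd (lev_mul hc hcC) (lev_pos n c')
    have h4 : Up (pL n) (Function.update (dec n e) v x') :=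
      h3.dvd (lev_dvd (Nat.zero_le c')) (pL_pos n)
    obtain ⟨e', he', ha, hd⟩ := exists_upd hv he x' (fun t ht => by
      have := h4 v t ht
      simpa using this)
    refine ⟨e', he', ⟨ha, (isUp_iff _ _ _ _).2 fun t ht => ?_⟩, by rw [hd]; exact h1⟩
    rw [hd]; exact h3 v t ht
  · rintro ⟨e', he', ⟨ha, -⟩, h⟩
    refine ⟨dec n e' v, ?_⟩
    rw [← agree_upd he he' ha]; exact h

theorem Up_of {n c c' v e e' : ℕ} (hc : c' < c) (he : e < pBnd n) (he' : e' < pBnd n)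
    (hu : Up (lev n c) (dec n e)) (ha : agree n v e e') (hi : isUp n v c' e') :
    Up (lev n c') (dec n e') := by
  have h1 : Up (lev n c') (dec n e) := hu.dvd (lev_dvd hc.le) (lev_pos n c')
  intro v' t ht
  by_cases hvv : v' = v
  · subst hvv; exact (isUp_iff _ _ _ _).1 hi t ht
  · rw [agree_upd he he' ha]
    simp only [Function.update_of_ne hvv]
    exact h1 v' t ht

theorem H_correct (K : FinKripke) (x n : ℕ) (hn : n = Nat.pair K.enc x) {T : ℕ}
    (hT : consistent n T) (φ : HyperQPTL) (hφ : φ.enc ≤ pC n) :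
    ∀ e, e < pBnd n → Up (lev n φ.enc) (dec n e) →
    (TH T φ.enc e ↔ HS K (dec n e) 0 φ) := by
  have hL := pL_pos n
  have key : ∀ (φ : HyperQPTL) (c v e : ℕ), φ.enc < c → c ≤ pC n → v < 2 * pC n + 2 →
      e < pBnd n → Up (lev n c) (dec n e) →
      (∀ e, e < pBnd n → Up (lev n φ.enc) (dec n e) → (TH T φ.enc e ↔ HS K (dec n e) 0 φ)) →
      ((∃ x, Con K x 0 ∧ HS K (Function.update (dec n e) v x) 0 φ) ↔
        ∃ e' < pBnd n, (agree n v e e' ∧ isUp n v φ.enc e' ∧ isCon n v e') ∧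
          TH T φ.enc e') ∧
      ((∃ x, Con K x 0 ∧ ¬ HS K (Function.update (dec n e) v x) 0 φ) ↔
        ∃ e' < pBnd n, (agree n v e e' ∧ isUp n v φ.enc e' ∧ isCon n v e') ∧
          ¬ TH T φ.enc e') ∧
      ((∃ x, HS K (Function.update (dec n e) v x) 0 φ) ↔
        ∃ e' < pBnd n, (agree n v e e' ∧ isUp n v φ.enc e') ∧
          TH T φ.enc e') ∧
      ((∃ x, ¬ HS K (Function.update (dec n e) v x) 0 φ) ↔
        ∃ e' < pBnd n, (agree n v e e' ∧ isUp n v φ.enc e') ∧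
          ¬ TH T φ.enc e') := by
    intro φ c v e hc hcC hv he hu ih
    have hlt : φ.enc < pC n := by omega
    have r1 := recog_HS (m := pm n) K φ
    have r2 := r1.map Not
    have le1 : Bd (pm n) φ.enc ≤ pN n := Bd_mono _ hlt.le
    have le2 : Bd (pm n) φ.enc * Bd (pm n) φ.enc ≤ pN n := sq_le' hlt
    have s1 := exists_step ((recog_body (K := K) r1 v).mono le2) hc hcC hv he hu
    have s2 := exists_step ((recog_body (K := K) r2 v).mono le2) hc hcC hv he hu
    have s3 := exists_step (r1.mono le1) hc hcC hv he hu
    have s4 := exists_step (r2.mono le1) hc hcC hv he hu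
    simp only [Function.update_self] at s1 s2
    have ih' : ∀ e', e' < pBnd n → agree n v e e' → isUp n v φ.enc e' →
        (TH T φ.enc e' ↔ HS K (dec n e') 0 φ) := fun e' he' ha hi =>
      ih e' he' (Up_of hc he he' hu ha hi)
    refine ⟨s1.trans ?_, s2.trans ?_, s3.trans ?_, s4.trans ?_⟩
    · refine exists_congr fun e' => and_congr_right fun he' => ?_
      rw [isCon_iff K x n hn]
      exact ⟨fun ⟨⟨h1, h2⟩, h3, h4⟩ => ⟨⟨h1, h2, h3⟩, (ih' e' he' h1 h2).2 h4⟩,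
        fun ⟨⟨h1, h2, h3⟩, h4⟩ => ⟨⟨h1, h2⟩, h3, (ih' e' he' h1 h2).1 h4⟩⟩
    · refine exists_congr fun e' => and_congr_right fun he' => ?_
      rw [isCon_iff K x n hn]
      exact ⟨fun ⟨⟨h1, h2⟩, h3, h4⟩ => ⟨⟨h1, h2, h3⟩, fun h => h4 ((ih' e' he' h1 h2).1 h)⟩,
        fun ⟨⟨h1, h2, h3⟩, h4⟩ => ⟨⟨h1, h2⟩, h3, fun h => h4 ((ih' e' he' h1 h2).2 h)⟩⟩
    · refine exists_congr fun e' => and_congr_right fun he' => ?_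
      exact and_congr_right fun h => (ih' e' he' h.1 h.2).symm
    · refine exists_congr fun e' => and_congr_right fun he' => ?_
      exact and_congr_right fun h => not_congr (ih' e' he' h.1 h.2).symm
  induction φ with
  | qf ψ =>
    intro e he hu
    rw [hT.2 _ (by omega) e he]
    have := Nat.right_le_pair 0 ψ.enc
    simp only [HyperQPTL.enc] at hφ
    have := QF_correct K x n hn hT ψ (by omega) he 0 (by omega)
    simp only [ruleH, HyperQPTL.enc, Nat.unpair_pair, HS]
    simp [this]
  | ex π φ ih =>
    intro e he hu
    rw [hT.2 _ (by omega) e he]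
    have hlt : φ.enc < Nat.pair 1 (Nat.pair π φ.enc) := enc_lt (by omega)
    have hv : π ≤ Nat.pair 1 (Nat.pair π φ.enc) :=
      (Nat.left_le_pair _ _).trans (Nat.right_le_pair _ _)
    simp only [HyperQPTL.enc] at hφ hu ⊢
    obtain ⟨k1, k2, k3, k4⟩ := key φ _ (2*π) e hlt hφ (by omega) he hu (ih (by omega))
    simp only [HS, k1, ruleH, Nat.unpair_pair]
    simp [hlt]
  | all π φ ih =>
    intro e he hu
    rw [hT.2 _ (by omega) e he]
    have hlt : φ.enc < Nat.pair 2 (Nat.pair π φ.enc) := enc_lt (by omega)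
    have hv : π ≤ Nat.pair 2 (Nat.pair π φ.enc) :=
      (Nat.left_le_pair _ _).trans (Nat.right_le_pair _ _)
    simp only [HyperQPTL.enc] at hφ hu ⊢
    obtain ⟨k1, k2, k3, k4⟩ := key φ _ (2*π) e hlt hφ (by omega) he hu (ih (by omega))
    have k := not_congr k2
    push Not at k
    simp only [HS, k, ruleH, Nat.unpair_pair]
    simp only [OfNat.ofNat_ne_zero, OfNat.ofNat_ne_one, false_and, false_or, true_and, hlt,
      Nat.reduceEqDiff, or_false]
    refine forall_congr' fun e' => forall_congr' fun _ => ?_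
    clear k k1 k2 k3 k4 key ih hT
    rw [← imp_iff_not_or]
  | pex π φ ih =>
    intro e he hu
    rw [hT.2 _ (by omega) e he]
    have hlt : φ.enc < Nat.pair 3 (Nat.pair π φ.enc) := enc_lt (by omega)
    have hv : π ≤ Nat.pair 3 (Nat.pair π φ.enc) :=
      (Nat.left_le_pair _ _).trans (Nat.right_le_pair _ _)
    simp only [HyperQPTL.enc] at hφ hu ⊢
    obtain ⟨k1, k2, k3, k4⟩ := key φ _ (2*π+1) e hlt hφ (by omega) he hu (ih (by omega))
    simp only [HS, k3, ruleH, Nat.unpair_pair]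
    simp [hlt]
  | pall π φ ih =>
    intro e he hu
    rw [hT.2 _ (by omega) e he]
    have hlt : φ.enc < Nat.pair 4 (Nat.pair π φ.enc) := enc_lt (by omega)
    have hv : π ≤ Nat.pair 4 (Nat.pair π φ.enc) :=
      (Nat.left_le_pair _ _).trans (Nat.right_le_pair _ _)
    simp only [HyperQPTL.enc] at hφ hu ⊢
    obtain ⟨k1, k2, k3, k4⟩ := key φ _ (2*π+1) e hlt hφ (by omega) he hu (ih (by omega))
    have k := not_congr k4
    push Not at k
    simp only [HS, k, ruleH, Nat.unpair_pair]
    simp only [OfNat.ofNat_ne_zero, OfNat.ofNat_ne_one, false_and, false_or, true_and, hlt,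
      Nat.reduceEqDiff, or_false]
    refine forall_congr' fun e' => forall_congr' fun _ => ?_
    clear k k1 k2 k3 k4 key ih hT
    rw [← imp_iff_not_or]

theorem main_correct (K : FinKripke) (φ : HyperQPTL) {T : ℕ}
    (hT : consistent (Nat.pair K.enc φ.enc) T) :
    TH T (pC (Nat.pair K.enc φ.enc)) 0 ↔ K.Models φ := by
  obtain ⟨n, hn⟩ : ∃ n, n = Nat.pair K.enc φ.enc := ⟨_, rfl⟩
  rw [← hn] at hT ⊢
  have hC : pC n = φ.enc := by rw [hn]; simp [pC]
  have hm : pm n = K.n + 2 := by rw [hn, pm_eq]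
  have h0 : ∀ v i, (dec n 0 v i).val = 0 := by
    intro v i; simp [dec, ltr, dig]
  have hB : 0 < pBnd n := Nat.pow_pos (pm_pos n)
  rw [hC, H_correct K φ.enc n hn hT φ hC.ge 0 hB
    (fun v t _ => Fin.ext (by rw [h0, h0])), HS_iff K hm.ge]
  have e1 : PiOf K (dec n 0) = fun _ _ => (∅ : Set ℕ) := by
    funext π i
    simp [PiOf, labL, h0]
  have e2 : sgOf (dec n 0) = fun _ => (∅ : Set ℕ) := by
    funext q
    simp [sgOf, h0]
  rw [e1, e2]
  rfl

end HQ

/-- **The HyperQPTL model checking problem is decidable**: there is a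
computable (total) function that, given (the encoding of) a finite Kripke
structure `K` and a HyperQPTL sentence `φ`, decides whether `K ⊨ φ`. -/
theorem hyperQPTL_model_checking_decidable :
    ∃ f : ℕ → Bool, Computable f ∧
      ∀ (K : FinKripke) (φ : HyperQPTL), φ.Closed →
        (f (Nat.pair K.enc φ.enc) = true ↔ K.Models φ) := by
  obtain ⟨f, hf, h⟩ := HQ.computable_search (R := HQ.consistent)
    (O := fun n T => HQ.TH T (HQ.pC n) 0) HQ.p_consistent
    (HQ.p_TH Primrec.snd (HQ.p_pC Primrec.fst) (Primrec.const 0)) HQ.exists_consistent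
  refine ⟨f, hf, fun K φ _ => ?_⟩
  obtain ⟨T, hT, hfT⟩ := h (Nat.pair K.enc φ.enc)
  rw [hfT]
  exact HQ.main_correct K φ hT
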